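/- arXiv:1605.01857 — 7 statements merged into one kernel-verified Lean document; each statement's English description precedes it below -/
import Mathlib

section
/- For every integer d ≥ 2, the graph Lad_d (the square of the path on 2d vertices) has diameter d and rainbow connection number rc(Lad_d) = d. -/
open SimpleGraph

/-- An edge-coloring `c` (colors on unordered pairs; only values on edges matter)
is a rainbow coloring of `G` if every pair of vertices is joined by a path
whose edges receive pairwise distinct colors. -/
def IsRainbowColoring {V α : Type*} (G : SimpleGraph V) (c : Sym2 V → α) : Prop :=
  ∀ u v : V, ∃ p : G.Walk u v, p.IsPath ∧ (p.edges.map c).Nodup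

/-- The rainbow connection number: the least `n` such that `G` has a rainbow
coloring using colors from `Fin n`. -/
noncomputable def rc {V : Type*} (G : SimpleGraph V) : ℕ :=
  sInf {n : ℕ | ∃ c : Sym2 V → Fin n, IsRainbowColoring G c}

/-- The eccentricity of a vertex: the largest distance from it to another vertex. -/
noncomputable def eccentricity {V : Type*} [Fintype V] (G : SimpleGraph V) (v : V) : ℕ :=
  Finset.univ.sup fun u => G.dist v u

/-- The diameter: the largest distance between a pair of vertices. -/
noncomputable def graphDiam {V : Type*} [Fintype V] (G : SimpleGraph V) : ℕ :=
  Finset.univ.sup fun p : V × V => G.dist p.1 p.2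

/-- The radius: the least eccentricity of a vertex. -/
noncomputable def graphRadius {V : Type*} [Fintype V] (G : SimpleGraph V) : ℕ :=
  sInf (Set.range (eccentricity G))

/-- The square of the path on `n` vertices: distinct vertices `i`, `j` are
adjacent iff `|i - j| ≤ 2`. For `n = 2 * d` this is the graph `Lad_d`. -/
def lad (n : ℕ) : SimpleGraph (Fin n) :=
  SimpleGraph.fromRel fun i j => |(i : ℤ) - (j : ℤ)| ≤ 2

theorem lad_adj {n : ℕ} {i j : Fin n} :
    (lad n).Adj i j ↔ i ≠ j ∧ |(i : ℤ) - (j : ℤ)| ≤ 2 := by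
  simp [lad, abs_sub_comm (j : ℤ)]

/-- A rainbow coloring with `n` colors bounds all distances by `n`. -/
theorem IsRainbowColoring.dist_le {V : Type*} {G : SimpleGraph V} {n : ℕ}
    {c : Sym2 V → Fin n} (h : IsRainbowColoring G c) (u v : V) : G.dist u v ≤ n := by
  obtain ⟨p, -, hp⟩ := h u v
  have hlen := hp.length_le_card
  rw [List.length_map, SimpleGraph.Walk.length_edges, Fintype.card_fin] at hlen
  exact (SimpleGraph.dist_le p).trans hlen

theorem lad_sub_le_two_mul_length {n : ℕ} {u v : Fin n} (p : (lad n).Walk u v) :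
    (v : ℤ) - u ≤ 2 * p.length := by
  induction p with
  | nil => simp
  | cons h p ih =>
    have := abs_le.1 (lad_adj.1 h).2
    rw [SimpleGraph.Walk.length_cons]
    push_cast
    linarith

/-- The coloring of `Lad_d` giving the edge `{i, i + 2}` the color `⌊i / 2⌋` and every edge
`{i, i + 1}` the color `d - 1`. -/
def ladColoring (d : ℕ) : Sym2 (Fin (2 * d)) → Fin d :=
  Sym2.lift ⟨fun i j => if ((i : ℕ) + j) % 2 = 0
    then ⟨min (i : ℕ) j / 2, by have := i.isLt; omega⟩
    else ⟨d - 1, by have := i.isLt; omega⟩, fun i j => by simp only [add_comm, min_comm]⟩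

theorem ladColoring_mk {d : ℕ} (i j : Fin (2 * d)) :
    (ladColoring d s(i, j) : ℕ) =
      if ((i : ℕ) + j) % 2 = 0 then min (i : ℕ) j / 2 else d - 1 := by
  simp only [ladColoring, Sym2.lift_mk]
  split_ifs <;> rfl

theorem exists_rainbow_path_of_eq_add_two_mul {d : ℕ} (k : ℕ) (u v : Fin (2 * d))
    (h : (v : ℕ) = u + 2 * k) :
    ∃ p : (lad (2 * d)).Walk u v, p.IsPath ∧ (p.edges.map (ladColoring d)).Nodup ∧
      (∀ w ∈ p.support, u ≤ w) ∧
      ∀ e ∈ p.edges, (u : ℕ) / 2 ≤ ladColoring d e ∧ (ladColoring d e : ℕ) < d - 1 := by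
  induction k generalizing u with
  | zero =>
    obtain rfl : v = u := Fin.ext (by simpa using h)
    exact ⟨.nil, by simp⟩
  | succ k ih =>
    have hlt : (u : ℕ) + 2 < 2 * d := by omega
    let m : Fin (2 * d) := ⟨u + 2, hlt⟩
    have hm : (m : ℕ) = u + 2 := rfl
    obtain ⟨p, hp, hc, hs, he⟩ := ih m (by omega)
    have hadj : (lad (2 * d)).Adj u m :=
      lad_adj.2 ⟨fun e => by have := congrArg Fin.val e; omega, by rw [abs_le]; omega⟩
    have hcol : (ladColoring d s(u, m) : ℕ) = (u : ℕ) / 2 := by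
      rw [ladColoring_mk, if_pos (by omega)]
      omega
    refine ⟨.cons hadj p, ?_, ?_, ?_, ?_⟩
    · refine (SimpleGraph.Walk.cons_isPath_iff _ _).2 ⟨hp, fun hu => ?_⟩
      have := Fin.le_def.1 (hs u hu)
      omega
    · rw [SimpleGraph.Walk.edges_cons, List.map_cons, List.nodup_cons]
      refine ⟨fun hmem => ?_, hc⟩
      obtain ⟨e, hep, hee⟩ := List.mem_map.1 hmem
      have := (he e hep).1
      rw [hee] at this
      omega
    · intro w hw
      rw [SimpleGraph.Walk.support_cons, List.mem_cons] at hw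
      rcases hw with rfl | hw
      · exact le_rfl
      · have := Fin.le_def.1 (hs w hw)
        exact Fin.le_def.2 (by omega)
    · intro e hmem
      rw [SimpleGraph.Walk.edges_cons, List.mem_cons] at hmem
      rcases hmem with rfl | hmem
      · omega
      · have := he e hmem
        omega

theorem exists_rainbow_path_of_le {d : ℕ} {u v : Fin (2 * d)} (h : u ≤ v) :
    ∃ p : (lad (2 * d)).Walk u v, p.IsPath ∧ (p.edges.map (ladColoring d)).Nodup := by
  rw [Fin.le_def] at h
  obtain ⟨k, hk | hk⟩ : ∃ k : ℕ, (v : ℕ) = u + 2 * k ∨ (v : ℕ) = u + 1 + 2 * k :=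
    ⟨((v : ℕ) - u) / 2, by omega⟩
  · obtain ⟨p, hp, hc, -, -⟩ := exists_rainbow_path_of_eq_add_two_mul k u v hk
    exact ⟨p, hp, hc⟩
  · have hlt : (u : ℕ) + 1 < 2 * d := by omega
    let m : Fin (2 * d) := ⟨u + 1, hlt⟩
    have hm : (m : ℕ) = u + 1 := rfl
    obtain ⟨p, hp, hc, hs, he⟩ := exists_rainbow_path_of_eq_add_two_mul k m v hk
    have hadj : (lad (2 * d)).Adj u m :=
      lad_adj.2 ⟨fun e => by have := congrArg Fin.val e; omega, by rw [abs_le]; omega⟩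
    have hcol : (ladColoring d s(u, m) : ℕ) = d - 1 := by
      rw [ladColoring_mk, if_neg (by omega)]
    refine ⟨.cons hadj p, (SimpleGraph.Walk.cons_isPath_iff _ _).2 ⟨hp, fun hu => ?_⟩, ?_⟩
    · have := Fin.le_def.1 (hs u hu)
      omega
    · rw [SimpleGraph.Walk.edges_cons, List.map_cons, List.nodup_cons]
      refine ⟨fun hmem => ?_, hc⟩
      obtain ⟨e, hep, hee⟩ := List.mem_map.1 hmem
      have := (he e hep).2
      rw [hee] at this
      omega

theorem isRainbowColoring_ladColoring (d : ℕ) :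
    IsRainbowColoring (lad (2 * d)) (ladColoring d) := by
  intro u v
  rcases le_total u v with h | h
  · exact exists_rainbow_path_of_le h
  · obtain ⟨p, hp, hc⟩ := exists_rainbow_path_of_le h
    refine ⟨p.reverse, hp.reverse, ?_⟩
    rwa [SimpleGraph.Walk.edges_reverse, List.map_reverse, List.nodup_reverse]

theorem le_dist_lad_ends {d : ℕ} (hd : 0 < d) :
    d ≤ (lad (2 * d)).dist ⟨0, by omega⟩ ⟨2 * d - 1, by omega⟩ := by
  obtain ⟨q, -, -⟩ := isRainbowColoring_ladColoring d ⟨0, by omega⟩ ⟨2 * d - 1, by omega⟩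
  obtain ⟨p, hp⟩ := q.reachable.exists_walk_length_eq_dist
  have := lad_sub_le_two_mul_length p
  rw [← hp]
  simp only at this
  omega

/-- For every `d ≥ 2`, the graph `Lad_d` (the square of the path on `2d` vertices)
has diameter `d` and rainbow connection number `d`. -/
theorem lad_diam_and_rc (d : ℕ) (hd : 2 ≤ d) :
    graphDiam (lad (2 * d)) = d ∧ rc (lad (2 * d)) = d := by
  have hrainbow := isRainbowColoring_ladColoring d
  have hends := le_dist_lad_ends (d := d) (by omega)
  refine ⟨le_antisymm (Finset.sup_le fun p _ => hrainbow.dist_le p.1 p.2) ?_,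
    le_antisymm (Nat.sInf_le ⟨_, hrainbow⟩) (le_csInf ⟨d, _, hrainbow⟩ ?_)⟩
  · exact hends.trans (Finset.le_sup (f := fun p : Fin (2 * d) × Fin (2 * d) =>
      (lad (2 * d)).dist p.1 p.2) (Finset.mem_univ (⟨0, by omega⟩, ⟨2 * d - 1, by omega⟩)))
  · rintro n ⟨c, hc⟩
    exact hends.trans (hc.dist_le _ _)
end

section
/- For every integer d ≥ 2, the graph Lad_{d+} (the square of the path on 2d+1 vertices) has diameter d and rainbow connection number rc(Lad_{d+}) = d. -/
open SimpleGraph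

theorem lad_adj_iff {n : ℕ} {u v : Fin n} :
    (lad n).Adj u v ↔ u ≠ v ∧ (u : ℕ) ≤ v + 2 ∧ (v : ℕ) ≤ u + 2 := by
  simp only [lad, SimpleGraph.fromRel_adj, abs_le]
  omega

theorem le_add_two_mul_length {n : ℕ} {u v : Fin n} (p : (lad n).Walk u v) :
    (v : ℕ) ≤ u + 2 * p.length := by
  induction p with
  | nil => simp
  | cons h p ih =>
    have := (lad_adj_iff.1 h).2.2
    rw [SimpleGraph.Walk.length_cons]
    omega

/-- The edge `{x, x + 2}` gets color `⌈x / 2⌉`, the edge `{x, x + 1}` gets color `x / 2` for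
even `x` and `0` for odd `x`. -/
def ladColor {n : ℕ} (e : Sym2 (Fin n)) : ℕ :=
  if (e.sup : ℕ) = e.inf + 2 then ((e.inf : ℕ) + 1) / 2
  else if (e.inf : ℕ) % 2 = 0 then (e.inf : ℕ) / 2 else 0

theorem ladColor_mk {n : ℕ} {u v : Fin n} (h : u ≤ v) :
    ladColor s(u, v) = if (v : ℕ) = u + 2 then ((u : ℕ) + 1) / 2
      else if (u : ℕ) % 2 = 0 then (u : ℕ) / 2 else 0 := by
  simp [ladColor, h]

/-- The path from `u` up to `v` that takes steps of size two as long as possible is rainbow. -/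
theorem exists_rainbow_path_of_le_s3 {d : ℕ} (u v : Fin (2 * d + 1)) (huv : u ≤ v) :
    ∃ p : (lad (2 * d + 1)).Walk u v, p.IsPath ∧ (p.edges.map ladColor).Nodup ∧
      2 * p.length ≤ v - u + 1 ∧ (∀ w ∈ p.support, u ≤ w) ∧
      ∀ e ∈ p.edges, ladColor e < d ∧
        (((u : ℕ) + 1) / 2 ≤ ladColor e ∨ (u : ℕ) % 2 = 1 ∧ ladColor e = 0) := by
  have huv' : (u : ℕ) ≤ v := huv
  have hv := v.isLt
  rcases Nat.lt_or_ge (v : ℕ) (u + 2) with h | h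
  · rcases Nat.eq_or_lt_of_le huv' with h0 | h1
    · obtain rfl := Fin.ext h0
      exact ⟨.nil, by simp⟩
    · have hadj : (lad (2 * d + 1)).Adj u v :=
        lad_adj_iff.2 ⟨fun h => by simp [h] at h1, by omega, by omega⟩
      refine ⟨.cons hadj .nil, ?_, by simp, ?_, by simp [huv], ?_⟩
      · simpa using hadj.ne
      · simp only [Walk.length_cons, Walk.length_nil]
        omega
      · simp only [Walk.edges_cons, Walk.edges_nil, List.mem_singleton, forall_eq,
          ladColor_mk huv]
        split_ifs <;> omega
  · let w : Fin (2 * d + 1) := ⟨u + 2, by omega⟩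
    have hw : (w : ℕ) = u + 2 := rfl
    have huw : u ≤ w := Fin.le_def.2 (by omega)
    have hadj : (lad (2 * d + 1)).Adj u w :=
      lad_adj_iff.2 ⟨fun h => by rw [← h] at hw; omega, by omega, by omega⟩
    obtain ⟨p, hp, hnd, hlen, hsupp, hcol⟩ := exists_rainbow_path_of_le_s3 w v (Fin.le_def.2 h)
    have hc : ladColor s(u, w) = ((u : ℕ) + 1) / 2 := by rw [ladColor_mk huw, if_pos hw]
    refine ⟨.cons hadj p, ?_, ?_, ?_, ?_, ?_⟩
    · refine (Walk.cons_isPath_iff _ _).2 ⟨hp, fun hu => ?_⟩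
      have := Fin.le_def.1 (hsupp u hu)
      omega
    · rw [Walk.edges_cons, List.map_cons, List.nodup_cons]
      refine ⟨fun hmem => ?_, hnd⟩
      obtain ⟨e, he, hee⟩ := List.mem_map.1 hmem
      have := hcol e he
      omega
    · rw [Walk.length_cons]
      omega
    · intro x hx
      rw [Walk.support_cons, List.mem_cons] at hx
      rcases hx with rfl | hx
      · exact le_rfl
      · exact huw.trans (hsupp x hx)
    · intro e he
      rw [Walk.edges_cons, List.mem_cons] at he
      rcases he with rfl | he
      · omega
      · have := hcol e he
        omega
termination_by (v : ℕ) - u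

theorem exists_rainbow_path {d : ℕ} (u v : Fin (2 * d + 1)) :
    ∃ p : (lad (2 * d + 1)).Walk u v, p.IsPath ∧ (p.edges.map ladColor).Nodup ∧
      p.length ≤ d ∧ ∀ e ∈ p.edges, ladColor e < d := by
  rcases le_total u v with h | h
  · obtain ⟨p, hp, hnd, hlen, -, hcol⟩ := exists_rainbow_path_of_le_s3 u v h
    exact ⟨p, hp, hnd, by omega, fun e he => (hcol e he).1⟩
  · obtain ⟨p, hp, hnd, hlen, -, hcol⟩ := exists_rainbow_path_of_le_s3 v u h
    refine ⟨p.reverse, hp.reverse, ?_, ?_, fun e he => (hcol e ?_).1⟩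
    · rwa [Walk.edges_reverse, List.map_reverse, List.nodup_reverse]
    · rw [Walk.length_reverse]
      omega
    · rwa [Walk.edges_reverse, List.mem_reverse] at he

theorem exists_isRainbowColoring_lad {d : ℕ} (hd : 0 < d) :
    ∃ c : Sym2 (Fin (2 * d + 1)) → Fin d, IsRainbowColoring (lad (2 * d + 1)) c := by
  refine ⟨fun e => ⟨ladColor e % d, Nat.mod_lt _ hd⟩, fun u v => ?_⟩
  obtain ⟨p, hp, hnd, -, hcol⟩ := exists_rainbow_path u v
  refine ⟨p, hp, List.Nodup.of_map Fin.val ?_⟩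
  rw [List.map_map]
  convert hnd using 1
  exact List.map_congr_left fun e he => Nat.mod_eq_of_lt (hcol e he)

theorem le_of_isRainbowColoring_lad {d n : ℕ} {c : Sym2 (Fin (2 * d + 1)) → Fin n}
    (hc : IsRainbowColoring (lad (2 * d + 1)) c) : d ≤ n := by
  obtain ⟨p, -, hnd⟩ := hc 0 (Fin.last (2 * d))
  have hlen := le_add_two_mul_length p
  have hcard := hnd.length_le_card
  simp only [List.length_map, Walk.length_edges, Fintype.card_fin] at hcard
  simp only [Fin.val_last, Fin.val_zero] at hlen
  omega

theorem graphDiam_lad (d : ℕ) : graphDiam (lad (2 * d + 1)) = d := by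
  refine le_antisymm (Finset.sup_le fun q _ => ?_) ?_
  · obtain ⟨p, -, -, hlen, -⟩ := exists_rainbow_path q.1 q.2
    exact (SimpleGraph.dist_le p).trans hlen
  · refine le_trans ?_ (Finset.le_sup (f := fun q : Fin (2 * d + 1) × Fin (2 * d + 1) =>
      (lad (2 * d + 1)).dist q.1 q.2) (Finset.mem_univ (0, Fin.last (2 * d))))
    obtain ⟨p, -⟩ := exists_rainbow_path (0 : Fin (2 * d + 1)) (Fin.last (2 * d))
    obtain ⟨q, hq⟩ := p.reachable.exists_walk_length_eq_dist
    have hlen := le_add_two_mul_length q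
    simp only [Fin.val_last, Fin.val_zero] at hlen
    simp only [← hq]
    omega

theorem rc_lad {d : ℕ} (hd : 0 < d) : rc (lad (2 * d + 1)) = d :=
  le_antisymm (Nat.sInf_le (exists_isRainbowColoring_lad hd))
    (le_csInf ⟨d, exists_isRainbowColoring_lad hd⟩
      fun _ ⟨_, hc⟩ => le_of_isRainbowColoring_lad hc)

/-- For every `d ≥ 2`, the graph `Lad_{d+}` (the square of the path on `2d+1` vertices)
has diameter `d` and rainbow connection number `d`. -/
theorem ladPlus_diam_and_rc (d : ℕ) (hd : 2 ≤ d) :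
    graphDiam (lad (2 * d + 1)) = d ∧ rc (lad (2 * d + 1)) = d := by
  exact ⟨graphDiam_lad d, rc_lad (by omega)⟩
end

section
/- If G is a maximal outerplanar graph with at least 3 vertices, then its rainbow connection number satisfies rc(G) ≤ 3·rad(G). -/
open SimpleGraph

/-- A graph is a path graph if it has a Hamiltonian path whose edges are
exactly all of its edges. -/
def IsPathGraph {W : Type*} (H : SimpleGraph W) : Prop :=
  ∃ (a b : W) (p : H.Walk a b), p.IsPath ∧ (∀ w : W, w ∈ p.support) ∧
    ∀ e : Sym2 W, e ∈ H.edgeSet ↔ e ∈ p.edges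

/-- A graph is 2-degenerate if every nonempty subgraph has a vertex of degree
at most 2. -/
def TwoDegenerate {V : Type*} (G : SimpleGraph V) : Prop :=
  ∀ H : G.Subgraph, H.verts.Nonempty → ∃ v ∈ H.verts, (H.neighborSet v).ncard ≤ 2

/-- A maximal outerplanar graph (MOP): a connected graph with at least two
vertices in which the neighbors of every vertex induce a path and which is
2-degenerate. -/
def IsMOP {V : Type*} [Fintype V] (G : SimpleGraph V) : Prop :=
  G.Connected ∧ 2 ≤ Fintype.card V ∧
    (∀ v : V, IsPathGraph (G.induce (G.neighborSet v))) ∧ TwoDegenerate G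

/-- `G` has an edge-coloring with colors below `n` in which any two vertices of `D` are joined by
a rainbow walk that stays inside `D`. -/
def RainbowOn {V : Type*} (G : SimpleGraph V) (D : Set V) (n : ℕ) : Prop :=
  ∃ c : Sym2 V → ℕ, ∀ u ∈ D, ∀ v ∈ D, ∃ p : G.Walk u v,
    (∀ x ∈ p.support, x ∈ D) ∧ (p.edges.map c).Nodup ∧ ∀ e ∈ p.edges, c e < n

/-- The vertices of a graph can be split into two classes such that every non-isolated vertex has a
neighbor in the other class. -/
theorem exists_bool_labelling {V : Type*} (H : SimpleGraph V) :
    ∃ l : V → Bool, ∀ v w, H.Adj v w → ∃ u, H.Adj v u ∧ l u ≠ l v := by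
  classical
  let root : V → V := fun v => (H.connectedComponentMk v).out
  have hroot : ∀ v, H.Reachable (root v) v := fun v =>
    SimpleGraph.ConnectedComponent.exact (Quot.out_eq _)
  have hadj : ∀ v w, H.Adj v w → root v = root w := fun v w h => by
    have : H.connectedComponentMk v = H.connectedComponentMk w :=
      SimpleGraph.ConnectedComponent.sound h.reachable
    simp only [root, this]
  refine ⟨fun v => decide (H.dist (root v) v % 2 = 0), fun v w hvw => ?_⟩
  obtain ⟨p, hp⟩ := (hroot v).symm.exists_walk_length_eq_dist
  rw [SimpleGraph.dist_comm] at hp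
  by_cases hv : root v = v
  · refine ⟨w, hvw, ?_⟩
    beta_reduce
    rw [← hadj v w hvw, hv, SimpleGraph.dist_eq_one_iff_adj.2 hvw, SimpleGraph.dist_self]
    simp
  · generalize hr : root v = r at *
    cases p with
    | nil => exact absurd rfl hv
    | @cons _ u _ h q =>
      refine ⟨u, h, ?_⟩
      beta_reduce
      rw [← hadj v u h, hr]
      have h1 : H.dist r u ≤ q.length := by
        rw [SimpleGraph.dist_comm]; exact SimpleGraph.dist_le q
      have h2 : H.dist r v ≤ H.dist r u + 1 := by
        obtain ⟨t, ht⟩ := (q.reachable.symm).exists_walk_length_eq_dist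
        have := SimpleGraph.dist_le (t.concat h.symm)
        rwa [SimpleGraph.Walk.length_concat, ht] at this
      rw [SimpleGraph.Walk.length_cons] at hp
      have h3 : H.dist r v = H.dist r u + 1 := by omega
      rw [h3, ne_eq, decide_eq_decide]
      omega

/-- A rainbow-connected set can be enlarged, at the cost of three colors, by vertices each having
a neighbor in the set and a second neighbor in the enlarged set. -/
theorem RainbowOn.extend {V : Type*} {G : SimpleGraph V} {D D' : Set V} {n : ℕ} (hsub : D ⊆ D')
    (hdeg : ∀ v ∈ D', v ∉ D → ∃ d ∈ D, G.Adj v d ∧ ∃ w ∈ D', w ≠ d ∧ G.Adj v w)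
    (h : RainbowOn G D n) : RainbowOn G D' (n + 3) := by
  classical
  obtain ⟨c, hc⟩ := h
  choose! g hgD hgadj k hkD' hkne hkadj using hdeg
  let H : SimpleGraph V :=
    { Adj := fun v w => G.Adj v w ∧ (v ∈ D' ∧ v ∉ D) ∧ (w ∈ D' ∧ w ∉ D)
      symm := ⟨fun v w h => ⟨h.1.symm, h.2.2, h.2.1⟩⟩
      loopless := ⟨fun v h => h.1.ne rfl⟩ }
  obtain ⟨l, hl⟩ := exists_bool_labelling H
  let T : V → V → Prop := fun v d => if ∃ w, H.Adj v w then l v = true else d = g v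
  let c' : Sym2 V → ℕ := fun e =>
    if ∀ x ∈ e, x ∈ D then c e
    else if ∀ x ∈ e, x ∉ D then n + 2
    else if ∃ v d, e = s(v, d) ∧ v ∉ D ∧ d ∈ D ∧ T v d then n else n + 1
  have hcDD : ∀ e, (∀ x ∈ e, x ∈ D) → c' e = c e := fun e he => if_pos he
  have hcLL : ∀ v w, v ∉ D → w ∉ D → c' s(v, w) = n + 2 := fun v w hv hw => by
    simp [c', hv, hw]
  have hcLD : ∀ v d, v ∉ D → d ∈ D → c' s(v, d) = if T v d then n else n + 1 := by
    intro v d hv hd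
    have : (∃ v' d', s(v, d) = s(v', d') ∧ v' ∉ D ∧ d' ∈ D ∧ T v' d') ↔ T v d := by
      constructor
      · rintro ⟨v', d', he, hv', hd', hT⟩
        rcases Sym2.eq_iff.1 he with ⟨rfl, rfl⟩ | ⟨rfl, rfl⟩
        · exact hT
        · exact absurd hd' hv
      · exact fun hT => ⟨v, d, rfl, hv, hd, hT⟩
    simp only [c', this]
    simp [hv, hd]
  have hcore : ∀ u ∈ D, ∀ v ∈ D, ∃ p : G.Walk u v,
      (∀ x ∈ p.support, x ∈ D) ∧ (p.edges.map c').Nodup ∧ ∀ e ∈ p.edges, c' e < n := by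
    intro u hu v hv
    obtain ⟨p, hpD, hpn, hpc⟩ := hc u hu v hv
    have heq : ∀ e ∈ p.edges, c' e = c e := fun e he =>
      hcDD e fun x hx => hpD x (SimpleGraph.Walk.mem_support_of_mem_edges he hx)
    refine ⟨p, hpD, ?_, fun e he => (heq e he).symm ▸ hpc e he⟩
    rwa [List.map_congr_left heq]
  have hdirect : ∀ v ∈ D', v ∉ D → ∃ d ∈ D, G.Adj v d ∧
      (c' s(v, d) = n ∨ c' s(v, d) = n + 1) := fun v hv' hv =>
    ⟨g v, hgD v hv' hv, hgadj v hv' hv, by rw [hcLD v _ hv (hgD v hv' hv)]; split_ifs <;> simp⟩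
  have htail : ∀ v ∈ D', v ∉ D → ∀ m, (m = n ∨ m = n + 1) → ∃ d ∈ D, ∃ p : G.Walk d v,
      (∀ x ∈ p.support, x ∈ D') ∧ (p.edges.map c').Nodup ∧
      ∀ e ∈ p.edges, c' e = m ∨ c' e = n + 2 := by
    intro v hv' hv m hm
    suffices hs : (∃ d ∈ D, G.Adj v d ∧ c' s(v, d) = m) ∨
        ∃ u ∈ D', u ∉ D ∧ G.Adj v u ∧ ∃ d ∈ D, G.Adj u d ∧ c' s(u, d) = m by
      rcases hs with ⟨d, hd, hvd, hcol⟩ | ⟨u, hu', hu, hvu, d, hd, hud, hcol⟩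
      · refine ⟨d, hd, .cons hvd.symm .nil, ?_, by simp, ?_⟩
        · simp [hv', hsub hd]
        · simp [Sym2.eq_swap (a := d), hcol]
      · refine ⟨d, hd, .cons hud.symm (.cons hvu.symm .nil), ?_, ?_, ?_⟩
        · simp [hv', hu', hsub hd]
        · simp [Sym2.eq_swap (a := d), hcol, hcLL u v hu hv]
          omega
        · simp [Sym2.eq_swap (a := d), hcol, hcLL u v hu hv]
    by_cases hiso : ∃ w, H.Adj v w
    · have hcol : ∀ x ∈ D', x ∉ D → (∃ w, H.Adj x w) →
          c' s(x, g x) = if l x = true then n else n + 1 := fun x hx' hx hw => by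
        rw [hcLD x _ hx (hgD x hx' hx)]
        simp only [T, if_pos hw]
      obtain ⟨w, hw⟩ := hiso
      obtain ⟨u, hu, hlu⟩ := hl v w hw
      by_cases hvm : c' s(v, g v) = m
      · exact .inl ⟨g v, hgD v hv' hv, hgadj v hv' hv, hvm⟩
      · obtain ⟨hu', huD⟩ := hu.2.2
        refine .inr ⟨u, hu', huD, hu.1, g u, hgD u hu' huD, hgadj u hu' huD, ?_⟩
        rw [hcol v hv' hv ⟨w, hw⟩] at hvm
        rw [hcol u hu' huD ⟨v, hu.symm⟩]
        cases h1 : l u <;> cases h2 : l v <;> simp_all <;> omega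
    · have hk : k v ∈ D := by
        by_contra hk
        exact hiso ⟨k v, hkadj v hv' hv, ⟨hv', hv⟩, hkD' v hv' hv, hk⟩
      left
      rcases hm with rfl | rfl
      · refine ⟨g v, hgD v hv' hv, hgadj v hv' hv, ?_⟩
        rw [hcLD v _ hv (hgD v hv' hv)]
        simp only [T, if_neg hiso, if_true]
      · refine ⟨k v, hk, hkadj v hv' hv, ?_⟩
        rw [hcLD v _ hv hk]
        simp only [T, if_neg hiso, if_neg (hkne v hv' hv)]
  have hreach : ∀ m, (m = n ∨ m = n + 1) → ∀ d ∈ D, ∀ v ∈ D', ∃ p : G.Walk d v,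
      (∀ x ∈ p.support, x ∈ D') ∧ (p.edges.map c').Nodup ∧
      ∀ e ∈ p.edges, c' e < n ∨ c' e = m ∨ c' e = n + 2 := by
    intro m hm d hd v hv'
    by_cases hv : v ∈ D
    · obtain ⟨p, h1, h2, h3⟩ := hcore d hd v hv
      exact ⟨p, fun x hx => hsub (h1 x hx), h2, fun e he => .inl (h3 e he)⟩
    · obtain ⟨d', hd', q, hq1, hq2, hq3⟩ := htail v hv' hv m hm
      obtain ⟨p, h1, h2, h3⟩ := hcore d hd d' hd'
      refine ⟨p.append q, fun x hx => ?_, ?_, fun e he => ?_⟩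
      · rcases (SimpleGraph.Walk.mem_support_append_iff p q).1 hx with hx | hx
        · exact hsub (h1 x hx)
        · exact hq1 x hx
      · rw [SimpleGraph.Walk.edges_append, List.map_append]
        refine h2.append hq2 ?_
        intro a ha hb
        obtain ⟨e, he, rfl⟩ := List.mem_map.1 ha
        obtain ⟨f, hf, hfe⟩ := List.mem_map.1 hb
        have := h3 e he
        have := hq3 f hf
        omega
      · rw [SimpleGraph.Walk.edges_append, List.mem_append] at he
        rcases he with he | he
        · exact .inl (h3 e he)
        · exact .inr (hq3 e he)
  refine ⟨c', fun u hu' v hv' => ?_⟩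
  by_cases hu : u ∈ D
  · obtain ⟨p, h1, h2, h3⟩ := hreach n (.inl rfl) u hu v hv'
    exact ⟨p, h1, h2, fun e he => by have := h3 e he; omega⟩
  · obtain ⟨d, hd, hud, hcol⟩ := hdirect u hu' hu
    obtain ⟨m, hm, hne⟩ : ∃ m, (m = n ∨ m = n + 1) ∧ c' s(u, d) ≠ m := by
      rcases hcol with h | h
      · exact ⟨n + 1, .inr rfl, by omega⟩
      · exact ⟨n, .inl rfl, by omega⟩
    obtain ⟨p, h1, h2, h3⟩ := hreach m hm d hd v hv'
    refine ⟨.cons hud p, ?_, ?_, ?_⟩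
    · simpa [hu'] using h1
    · rw [SimpleGraph.Walk.edges_cons, List.map_cons, List.nodup_cons]
      refine ⟨fun hmem => ?_, h2⟩
      obtain ⟨e, he, hee⟩ := List.mem_map.1 hmem
      have := h3 e he
      omega
    · intro e he
      rw [SimpleGraph.Walk.edges_cons, List.mem_cons] at he
      rcases he with rfl | he
      · omega
      · have := h3 e he
        omega

theorem IsPathGraph.preconnected {W : Type*} {H : SimpleGraph W} (h : IsPathGraph H) :
    H.Preconnected := by
  classical
  obtain ⟨a, b, p, -, hsupp, -⟩ := h
  have ha : ∀ w, H.Reachable a w := fun w => ⟨p.takeUntil w (hsupp w)⟩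
  exact fun u v => (ha u).symm.trans (ha v)

/-- If the neighbors of `v` induce a connected graph and `v` has two distinct neighbors `w` and
`x`, then `v` and `w` have a common neighbor. -/
theorem exists_common_neighbor_of_preconnected {V : Type*} {G : SimpleGraph V} {v w x : V}
    (h : (G.induce (G.neighborSet v)).Preconnected) (hw : G.Adj v w) (hx : G.Adj v x)
    (hne : x ≠ w) : ∃ u, G.Adj v u ∧ G.Adj w u := by
  obtain ⟨p⟩ := h ⟨w, hw⟩ ⟨x, hx⟩
  cases p with
  | nil => exact absurd rfl hne
  | @cons _ u _ hadj _ => exact ⟨u.1, u.2, hadj⟩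

/-- Every edge of a maximal outerplanar graph with at least three vertices lies in a triangle. -/
theorem IsMOP.exists_common_neighbor {V : Type*} [Fintype V] {G : SimpleGraph V}
    (hG : IsMOP G) (hn : 3 ≤ Fintype.card V) {v w : V} (hvw : G.Adj v w) :
    ∃ u, G.Adj v u ∧ G.Adj w u := by
  classical
  obtain ⟨hconn, -, hpath, -⟩ := hG
  by_contra hno
  have hv : ∀ x, G.Adj v x → x = w := fun x hx => by
    by_contra hne
    exact hno (exists_common_neighbor_of_preconnected (hpath v).preconnected hvw hx hne)
  have hw : ∀ x, G.Adj w x → x = v := fun x hx => by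
    by_contra hne
    obtain ⟨u, h1, h2⟩ :=
      exists_common_neighbor_of_preconnected (hpath w).preconnected hvw.symm hx hne
    exact hno ⟨u, h2, h1⟩
  have hclosed : ∀ a b, G.Walk a b → (a = v ∨ a = w) → b = v ∨ b = w := by
    intro a b p
    induction p with
    | nil => exact id
    | cons h _ ih =>
      rintro (rfl | rfl)
      · exact ih (.inr (hv _ h))
      · exact ih (.inl (hw _ h))
  have hall : (Finset.univ : Finset V) ⊆ {v, w} := fun x _ => by
    obtain ⟨p⟩ := hconn.preconnected v x
    simpa using hclosed v x p (.inl rfl)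
  have := (Finset.card_le_card hall).trans Finset.card_le_two
  rw [Finset.card_univ] at this
  omega

/-- If every edge of a connected graph lies in a triangle, then the ball of radius `r` around a
vertex is rainbow connected with `3 * r` colors. -/
theorem rainbowOn_ball {V : Type*} {G : SimpleGraph V} (hconn : G.Connected)
    (htri : ∀ v w, G.Adj v w → ∃ u, G.Adj v u ∧ G.Adj w u) (a : V) (r : ℕ) :
    RainbowOn G {x | G.dist a x ≤ r} (3 * r) := by
  induction r with
  | zero =>
    refine ⟨fun _ => 0, fun u hu v hv => ?_⟩
    have h : ∀ x, G.dist a x ≤ 0 → a = x := fun x hx =>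
      hconn.dist_eq_zero_iff.1 (Nat.le_zero.1 hx)
    obtain rfl := h u hu
    obtain rfl := h v hv
    exact ⟨.nil, by simp, by simp, by simp⟩
  | succ r ih =>
    have hsub : {x | G.dist a x ≤ r} ⊆ {x | G.dist a x ≤ r + 1} := fun x hx => Nat.le_succ_of_le hx
    refine ih.extend hsub fun v hv hv' => ?_
    simp only [Set.mem_ofPred_eq] at hv hv'
    obtain ⟨p, hp⟩ := hconn.exists_walk_length_eq_dist v a
    rw [SimpleGraph.dist_comm] at hp
    cases p with
    | nil => simp at hv'
    | @cons _ d _ hvd q =>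
      rw [SimpleGraph.Walk.length_cons] at hp
      have hd : G.dist a d ≤ r := by
        have := SimpleGraph.dist_le q
        rw [SimpleGraph.dist_comm] at this
        omega
      obtain ⟨u, hvu, hdu⟩ := htri v d hvd
      have htriangle := hconn.dist_triangle (u := a) (v := d) (w := u)
      rw [SimpleGraph.dist_eq_one_iff_adj.2 hdu] at htriangle
      exact ⟨d, hd, hvd, u, by simp only [Set.mem_ofPred_eq]; omega, hdu.ne', hvu⟩

theorem RainbowOn.rc_le {V : Type*} {G : SimpleGraph V} {n : ℕ} (hn : 0 < n)
    (h : RainbowOn G Set.univ n) : rc G ≤ n := by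
  classical
  obtain ⟨c, hc⟩ := h
  refine Nat.sInf_le ⟨fun e => if he : c e < n then ⟨c e, he⟩ else ⟨0, hn⟩, fun u v => ?_⟩
  obtain ⟨p, -, hp, hlt⟩ := hc u trivial v trivial
  refine ⟨p.bypass, p.bypass_isPath, p.bypass_isPath.isTrail.edges_nodup.map_on ?_⟩
  intro e he f hf hef
  have he := p.edges_bypass_subset_edges he
  have hf := p.edges_bypass_subset_edges hf
  rw [dif_pos (hlt e he), dif_pos (hlt f hf)] at hef
  exact List.inj_on_of_nodup_map hp he hf (congrArg Fin.val hef)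

/-- If `G` is a maximal outerplanar graph with at least 3 vertices, then
`rc(G) ≤ 3 · rad(G)`. -/
theorem mop_rc_le_three_rad {V : Type*} [Fintype V] (G : SimpleGraph V)
    (hG : IsMOP G) (hn : 3 ≤ Fintype.card V) :
    rc G ≤ 3 * graphRadius G := by
  have hconn := hG.1
  have := hconn.nonempty
  obtain ⟨a, ha⟩ : graphRadius G ∈ Set.range (eccentricity G) :=
    Nat.sInf_mem (Set.range_nonempty _)
  have hdist : ∀ x, G.dist a x ≤ graphRadius G := fun x =>
    ha ▸ Finset.le_sup (f := fun u => G.dist a u) (Finset.mem_univ x)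
  have hpos : 0 < graphRadius G := by
    have : Nontrivial V := Fintype.one_lt_card_iff_nontrivial.1 (by omega)
    obtain ⟨x, hx⟩ := exists_ne a
    exact (hconn.pos_dist_of_ne hx.symm).trans_le (hdist x)
  have hball := rainbowOn_ball hconn (fun v w => hG.exists_common_neighbor hn) a (graphRadius G)
  rw [Set.eq_univ_of_forall (s := {x | G.dist a x ≤ graphRadius G}) hdist] at hball
  exact hball.rc_le (by omega)
end

section
/- For every integer n ≥ 4, the cycle C_n on n vertices has rainbow connection number rc(C_n) = n/2 if n is even and rc(C_n) = ⌈n/2⌉ if n is odd. -/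
open SimpleGraph

namespace SimpleGraph.cycleGraph

section

open scoped Fin.CommRing

/-- The edge of a cycle joining `i` to its successor. -/
def succEdge {n : ℕ} (i : Fin (n + 2)) : Sym2 (Fin (n + 2)) := s(i, i + 1)

lemma succEdge_injective {n : ℕ} (hn : 1 ≤ n) :
    Function.Injective (succEdge : Fin (n + 2) → Sym2 (Fin (n + 2))) := by
  intro i j h
  rcases Sym2.eq_iff.mp h with ⟨h, -⟩ | ⟨h₁, h₂⟩
  · exact h
  · have h2 : ((2 : ℤ) : Fin (n + 2)) = 0 := by
      push_cast
      linear_combination h₂ - h₁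
    rw [CharP.intCast_eq_zero_iff (Fin (n + 2)) (n + 2)] at h2
    have := Int.le_of_dvd (by norm_num) h2
    omega

lemma adj_add_one {n : ℕ} (u : Fin (n + 2)) : (cycleGraph (n + 2)).Adj u (u + 1) := by
  rw [cycleGraph_adj]
  right
  ring

/-- A walk in a cycle lifts to a walk on the integers; if its displacement equals its length,
then it only moves forward. -/
lemma exists_displacement {n : ℕ} {u v : Fin (n + 2)} (p : (cycleGraph (n + 2)).Walk u v) :
    ∃ d : ℤ, v = u + d ∧ |d| ≤ p.length ∧
      (d = p.length → p.edges =
        (List.range p.length).map fun j : ℕ ↦ succEdge (u + (j : Fin (n + 2)))) := by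
  induction p with
  | nil => exact ⟨0, by simp⟩
  | @cons u w v h p ih =>
    obtain ⟨d, hv, hd, hedges⟩ := ih
    rw [abs_le] at hd
    rcases cycleGraph_adj.mp h with h' | h'
    · refine ⟨d - 1, ?_, ?_, ?_⟩
      · rw [hv]
        push_cast
        linear_combination -h'
      · rw [abs_le, Walk.length_cons]
        push_cast
        omega
      · intro hlen
        rw [Walk.length_cons] at hlen
        push_cast at hlen
        omega
    · obtain rfl : w = u + 1 := by linear_combination h'
      refine ⟨d + 1, ?_, ?_, ?_⟩
      · rw [hv]
        push_cast
        ring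
      · rw [abs_le, Walk.length_cons]
        push_cast
        omega
      · intro hlen
        rw [Walk.length_cons] at hlen
        push_cast at hlen
        rw [Walk.edges_cons, Walk.length_cons, hedges (by omega), List.range_succ_eq_map]
        simp only [List.map_cons, List.map_map, Nat.cast_zero, add_zero, succEdge]
        refine congrArg (s(u, u + 1) :: ·) ?_
        refine List.map_congr_left fun j _ ↦ ?_
        simp only [Function.comp_apply, Nat.cast_succ]
        rw [show u + 1 + (j : Fin (n + 2)) = u + (j + 1) by ring]

lemma length_le_of_nodup_map {V : Type*} {G : SimpleGraph V} {k : ℕ} {c : Sym2 V → Fin k}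
    {u v : V} {p : G.Walk u v} (hp : (p.edges.map c).Nodup) : p.length ≤ k := by
  simpa using hp.length_le_card

lemma dvd_displacement_sub {n m : ℕ} {u : Fin (n + 2)} {d : ℤ} (h : u + (m : Fin (n + 2)) = u + d) :
    ∃ t : ℤ, d = m + (n + 2) * t := by
  have h' : ((d - m : ℤ) : Fin (n + 2)) = 0 := by
    push_cast
    linear_combination -h
  obtain ⟨t, ht⟩ := (CharP.intCast_eq_zero_iff (Fin (n + 2)) (n + 2) _).mp h'
  exact ⟨t, by push_cast at ht; linarith⟩

lemma le_of_isRainbowColoring {n k : ℕ} {c : Sym2 (Fin (n + 2)) → Fin k}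
    (hc : IsRainbowColoring (cycleGraph (n + 2)) c) : (n + 2) / 2 ≤ k := by
  obtain ⟨p, -, hp⟩ := hc 0 (0 + ((n + 2) / 2 : ℕ))
  obtain ⟨d, hd, hle, -⟩ := exists_displacement p
  obtain ⟨t, ht⟩ := dvd_displacement_sub hd
  have hk := length_le_of_nodup_map hp
  rw [abs_le] at hle
  rcases lt_or_ge t 0 with h0 | h0
  · have : ((n : ℤ) + 2) * t ≤ (n + 2) * (-1) := mul_le_mul_of_nonneg_left (by omega) (by omega)
    omega
  · have : 0 ≤ ((n : ℤ) + 2) * t := by positivity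
    omega

/-- With only `k` colors on the cycle of length `2k + 1`, every arc of length `k` is rainbow. -/
lemma injOn_arc_of_isRainbowColoring {n k : ℕ} (hn : n + 2 = 2 * k + 1)
    {c : Sym2 (Fin (n + 2)) → Fin k} (hc : IsRainbowColoring (cycleGraph (n + 2)) c)
    (u : Fin (n + 2)) {i j : ℕ} (hi : i < k) (hj : j < k)
    (h : c (succEdge (u + i)) = c (succEdge (u + j))) : i = j := by
  obtain ⟨p, -, hp⟩ := hc u (u + k)
  obtain ⟨d, hd, hle, hedges⟩ := exists_displacement p
  obtain ⟨t, ht⟩ := dvd_displacement_sub hd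
  have hk := length_le_of_nodup_map hp
  rw [abs_le] at hle
  have hlen : d = p.length ∧ p.length = k := by
    rcases lt_or_ge t 0 with h0 | h0
    · have : ((n : ℤ) + 2) * t ≤ (n + 2) * (-1) := mul_le_mul_of_nonneg_left (by omega) (by omega)
      omega
    · have : 0 ≤ ((n : ℤ) + 2) * t := by positivity
      omega
  rw [hedges hlen.1, hlen.2, List.map_map] at hp
  exact List.inj_on_of_nodup_map hp (List.mem_range.mpr hi) (List.mem_range.mpr hj) h

lemma not_isRainbowColoring_odd {n k : ℕ} (hk : 2 ≤ k) (hn : n + 2 = 2 * k + 1)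
    (c : Sym2 (Fin (n + 2)) → Fin k) : ¬ IsRainbowColoring (cycleGraph (n + 2)) c := by
  intro hc
  have shift (u : Fin (n + 2)) : c (succEdge (u + k)) = c (succEdge u) := by
    have hinj : Function.Injective fun j : Fin k ↦ c (succEdge (u + (j : ℕ))) :=
      fun i j h ↦ Fin.ext (injOn_arc_of_isRainbowColoring hn hc u i.2 j.2 h)
    obtain ⟨⟨j, hj⟩, hjc⟩ := Finite.surjective_of_injective hinj (c (succEdge (u + k)))
    simp only at hjc
    rcases j with _ | j
    · simpa using hjc.symm
    · have := injOn_arc_of_isRainbowColoring hn hc (u + 1) (i := j) (j := k - 1)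
        (by omega) (by omega) (by
          rw [Nat.cast_sub (by omega)]
          convert hjc using 3 <;> (push_cast; ring))
      omega
  have hcast : (k : Fin (n + 2)) + k + 1 = 0 := by
    have : ((2 * k + 1 : ℕ) : Fin (n + 2)) = 0 := by
      rw [CharP.cast_eq_zero_iff (Fin (n + 2)) (n + 2), hn]
    push_cast at this
    linear_combination this
  have h := (shift (1 + k)).trans (shift 1)
  rw [show (1 + k + k : Fin (n + 2)) = 0 by linear_combination hcast] at h
  have := injOn_arc_of_isRainbowColoring hn hc 0 (i := 0) (j := 1) (by omega) (by omega)
    (by simpa using h)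
  omega

lemma exists_forward_walk {n : ℕ} (u : Fin (n + 2)) (k : ℕ) :
    ∃ p : (cycleGraph (n + 2)).Walk u (u + k),
      p.support = (List.range (k + 1)).map (fun j : ℕ ↦ u + (j : Fin (n + 2))) ∧
      p.edges = (List.range k).map fun j : ℕ ↦ succEdge (u + (j : Fin (n + 2))) := by
  induction k with
  | zero => exact ⟨Walk.nil.copy rfl (by simp), by simp⟩
  | succ k ih =>
    obtain ⟨p, hs, he⟩ := ih
    refine ⟨(p.concat (adj_add_one _)).copy rfl (by push_cast; ring), ?_, ?_⟩
    · rw [Walk.support_copy, Walk.support_concat, hs, List.range_succ (n := k + 1)]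
      simp [add_assoc]
    · rw [Walk.edges_copy, Walk.edges_concat, he, List.range_succ]
      simp [succEdge]

lemma val_add_natCast {n : ℕ} (u : Fin (n + 2)) {j : ℕ} (hj : j < n + 2) :
    (u + (j : Fin (n + 2))).val = if u.val + j < n + 2 then u.val + j else u.val + j - (n + 2) := by
  rw [Fin.val_add, Fin.val_natCast, Nat.mod_eq_of_lt hj]
  split_ifs with h
  · exact Nat.mod_eq_of_lt h
  · rw [Nat.mod_eq_sub_mod (by omega), Nat.mod_eq_of_lt (by omega)]

lemma mod_eq_ite {x m : ℕ} (h : x < 2 * m) : x % m = if x < m then x else x - m := by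
  split_ifs with hx
  · exact Nat.mod_eq_of_lt hx
  · rw [Nat.mod_eq_sub_mod (by omega), Nat.mod_eq_of_lt (by omega)]

lemma exists_isRainbowColoring {n : ℕ} (hn : 1 ≤ n) :
    ∃ c : Sym2 (Fin (n + 2)) → Fin ((n + 3) / 2), IsRainbowColoring (cycleGraph (n + 2)) c := by
  have hm : 0 < (n + 3) / 2 := by omega
  set m := (n + 3) / 2 with hmdef
  let f : Fin (n + 2) → Fin m := fun i ↦ ⟨i.val % m, Nat.mod_lt _ hm⟩
  let c : Sym2 (Fin (n + 2)) → Fin m := Function.extend succEdge f fun _ ↦ ⟨0, hm⟩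
  have hcf (i : Fin (n + 2)) : c (succEdge i) = f i := (succEdge_injective hn).extend_apply _ _ _
  have forward (u : Fin (n + 2)) (k : ℕ) (hk : k ≤ (n + 2) / 2) :
      ∃ p : (cycleGraph (n + 2)).Walk u (u + k), p.IsPath ∧ (p.edges.map c).Nodup := by
    obtain ⟨p, hs, he⟩ := exists_forward_walk u k
    refine ⟨p, ?_, ?_⟩
    · rw [Walk.isPath_def, hs]
      refine List.Nodup.map_on (fun i hi j hj h ↦ ?_) List.nodup_range
      rw [List.mem_range] at hi hj
      have h' := congrArg Fin.val (add_left_cancel h)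
      rwa [Fin.val_natCast, Fin.val_natCast, Nat.mod_eq_of_lt (by omega),
        Nat.mod_eq_of_lt (by omega)] at h'
    · rw [he, List.map_map]
      refine List.Nodup.map_on (fun i hi j hj h ↦ ?_) List.nodup_range
      rw [List.mem_range] at hi hj
      simp only [Function.comp_apply, hcf, f, Fin.mk.injEq] at h
      have hu := u.2
      rw [mod_eq_ite ((Fin.is_lt _).trans_le (by omega)),
        mod_eq_ite ((Fin.is_lt _).trans_le (by omega)), val_add_natCast u (by omega),
        val_add_natCast u (by omega)] at h
      split_ifs at h <;> omega
  refine ⟨c, fun u v ↦ ?_⟩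
  have forward' (u v : Fin (n + 2)) (h : (v - u).val ≤ (n + 2) / 2) :
      ∃ p : (cycleGraph (n + 2)).Walk u v, p.IsPath ∧ (p.edges.map c).Nodup := by
    have := forward u _ h
    rwa [Fin.cast_val_eq_self, add_sub_cancel] at this
  rcases le_or_gt (v - u).val ((n + 2) / 2) with h | h
  · exact forward' u v h
  · obtain ⟨p, hp, hpc⟩ := forward' v u (by
      rw [← neg_sub, Fin.val_neg]
      split_ifs <;> omega)
    exact ⟨p.reverse, hp.reverse, by simpa using hpc⟩

lemma rc_eq_of_forall_le {V : Type*} {G : SimpleGraph V} {m : ℕ}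
    (hm : ∃ c : Sym2 V → Fin m, IsRainbowColoring G c)
    (h : ∀ (k : ℕ) (c : Sym2 V → Fin k), IsRainbowColoring G c → m ≤ k) : rc G = m :=
  le_antisymm (Nat.sInf_le hm) (le_csInf ⟨m, hm⟩ fun k ⟨c, hc⟩ ↦ h k c hc)

end

end SimpleGraph.cycleGraph

/-- For `n ≥ 4`, the cycle `C_n` has rainbow connection number `n/2` if `n` is
even and `⌈n/2⌉` if `n` is odd. -/
theorem rc_cycleGraph (n : ℕ) (hn : 4 ≤ n) :
    (Even n → rc (SimpleGraph.cycleGraph n) = n / 2) ∧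
      (Odd n → rc (SimpleGraph.cycleGraph n) = (n + 1) / 2) := by
  obtain ⟨n, rfl⟩ : ∃ k, n = k + 2 := ⟨n - 2, by omega⟩
  have hrc : ∃ c : Sym2 (Fin (n + 2)) → Fin ((n + 2 + 1) / 2),
      IsRainbowColoring (SimpleGraph.cycleGraph (n + 2)) c :=
    cycleGraph.exists_isRainbowColoring (by omega)
  constructor
  · rintro ⟨m, hm⟩
    rw [show (n + 2 + 1) / 2 = (n + 2) / 2 by omega] at hrc
    exact cycleGraph.rc_eq_of_forall_le hrc fun k c hc ↦ cycleGraph.le_of_isRainbowColoring hc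
  · rintro ⟨m, hm⟩
    refine cycleGraph.rc_eq_of_forall_le hrc fun k c hc ↦ ?_
    have hle := cycleGraph.le_of_isRainbowColoring hc
    by_contra! hlt
    exact cycleGraph.not_isRainbowColoring_odd (by omega) (by omega) c hc
end

section
/- For every integer n ≥ 2, the fan graph Fan_n satisfies: rc(Fan_n) = 1 if n = 2; rc(Fan_n) = 2 if 3 ≤ n ≤ 6; and rc(Fan_n) = 3 if n ≥ 7. -/
open SimpleGraph

/-- The fan graph `Fan_n = P_n ∨ K_1`: the vertices `some i` (`i : Fin n`) form a
path `v_1, …, v_n`, while `none` is a central vertex adjacent to every path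
vertex. -/
def fan (n : ℕ) : SimpleGraph (Option (Fin n)) :=
  SimpleGraph.fromRel fun a b =>
    match a, b with
    | none, some _ => True
    | some i, some j => (i : ℕ) + 1 = (j : ℕ)
    | _, _ => False

@[simp]
theorem fan_adj_none_some {n : ℕ} (i : Fin n) : (fan n).Adj none (some i) := by
  simp [fan]

@[simp]
theorem fan_adj_some_none {n : ℕ} (i : Fin n) : (fan n).Adj (some i) none := by
  simp [fan]

theorem fan_adj_some_some {n : ℕ} (i j : Fin n) :
    (fan n).Adj (some i) (some j) ↔ (i : ℕ) + 1 = j ∨ (j : ℕ) + 1 = i := by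
  simp only [fan, SimpleGraph.fromRel_adj, ne_eq, Option.some.injEq, Fin.ext_iff]
  omega

section RainbowPath

variable {V α : Type*} {G : SimpleGraph V}

/-- Two vertices are rainbow connected if a path with pairwise distinct colors joins them. -/
def RainbowConnected (G : SimpleGraph V) (c : Sym2 V → α) (u v : V) : Prop :=
  ∃ p : G.Walk u v, p.IsPath ∧ (p.edges.map c).Nodup

theorem RainbowConnected.refl (c : Sym2 V → α) (u : V) : RainbowConnected G c u u :=
  ⟨Walk.nil, by simp, by simp⟩

theorem RainbowConnected.symm {c : Sym2 V → α} {u v : V} (h : RainbowConnected G c u v) :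
    RainbowConnected G c v u := by
  obtain ⟨p, hp, hc⟩ := h
  exact ⟨p.reverse, hp.reverse, by simpa using hc⟩

theorem SimpleGraph.Adj.rainbowConnected {u v : V} (h : G.Adj u v) (c : Sym2 V → α) :
    RainbowConnected G c u v :=
  ⟨h.toWalk, by simp [h.ne], by simp⟩

theorem RainbowConnected.of_two_edges {c : Sym2 V → α} {u v w : V} (huv : G.Adj u v)
    (hvw : G.Adj v w) (huw : u ≠ w) (hc : c s(u, v) ≠ c s(v, w)) : RainbowConnected G c u w :=
  ⟨.cons huv (.cons hvw .nil), by simp [huv.ne, hvw.ne, huw], by simp [hc]⟩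

theorem RainbowConnected.of_three_edges {c : Sym2 V → α} {u v w x : V} (huv : G.Adj u v)
    (hvw : G.Adj v w) (hwx : G.Adj w x) (huw : u ≠ w) (hux : u ≠ x) (hvx : v ≠ x)
    (h₁ : c s(u, v) ≠ c s(v, w)) (h₂ : c s(u, v) ≠ c s(w, x)) (h₃ : c s(v, w) ≠ c s(w, x)) :
    RainbowConnected G c u x :=
  ⟨.cons huv (.cons hvw (.cons hwx .nil)),
    by simp [huv.ne, hvw.ne, hwx.ne, huw, hux, hvx], by simp [h₁, h₂, h₃]⟩

/-- A rainbow path has at most as many edges as there are colors. -/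
theorem SimpleGraph.Walk.length_le_of_nodup_map_edges {k : ℕ} {c : Sym2 V → Fin k} {u v : V}
    (p : G.Walk u v) (hp : (p.edges.map c).Nodup) : p.length ≤ k := by
  simpa using hp.length_le_card

end RainbowPath

/-- The coloring of the edges of the fan giving the spoke at `i` the color `s i` and the path
edge from `i` to `i + 1` the color `e i`. -/
def fanColoring {α : Type*} (n : ℕ) (s e : ℕ → α) : Sym2 (Option (Fin n)) → α :=
  Sym2.lift ⟨fun a b =>
    match a, b with
    | none, none => s 0
    | none, some i => s i
    | some i, none => s i
    | some i, some j => e (min (i : ℕ) j), by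
      rintro (_ | i) (_ | j) <;> simp [min_comm]⟩

section FanColoring

variable {α : Type*} {n : ℕ} (s e : ℕ → α)

@[simp]
theorem fanColoring_none_some (i : Fin n) : fanColoring n s e s(none, some i) = s i := rfl

@[simp]
theorem fanColoring_some_none (i : Fin n) : fanColoring n s e s(some i, none) = s i := rfl

@[simp]
theorem fanColoring_some_some (i j : Fin n) :
    fanColoring n s e s(some i, some j) = e (min (i : ℕ) j) := rfl

end FanColoring

/-- To check a rainbow coloring of the fan, only nonadjacent path vertices matter. -/
theorem isRainbowColoring_fan {α : Type*} {n : ℕ} {c : Sym2 (Option (Fin n)) → α}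
    (h : ∀ i j : Fin n, (i : ℕ) + 1 < j → RainbowConnected (fan n) c (some i) (some j)) :
    IsRainbowColoring (fan n) c := by
  have key : ∀ i j : Fin n, i < j → RainbowConnected (fan n) c (some i) (some j) := by
    intro i j hij
    rcases Nat.lt_or_ge (i + 1) j with hlt | hge
    · exact h i j hlt
    · exact ((fan_adj_some_some i j).2 (by omega)).rainbowConnected c
  rintro (_ | i) (_ | j)
  · exact RainbowConnected.refl c _
  · exact (fan_adj_none_some j).rainbowConnected c
  · exact (fan_adj_some_none i).rainbowConnected c
  · rcases lt_trichotomy i j with hij | rfl | hij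
    · exact key i j hij
    · exact RainbowConnected.refl c _
    · exact (key j i hij).symm

theorem isRainbowColoring_fan_two (c : Sym2 (Option (Fin 2)) → Fin 1) :
    IsRainbowColoring (fan 2) c :=
  isRainbowColoring_fan fun i j hij => by omega

theorem exists_isRainbowColoring_fan_of_le_six {n : ℕ} (hn : n ≤ 6) :
    ∃ c : Sym2 (Option (Fin n)) → Fin 2, IsRainbowColoring (fan n) c := by
  refine ⟨fanColoring n (fun i => if i < 3 then 0 else 1) (fun i => if i % 2 = 0 then 0 else 1),
    isRainbowColoring_fan fun i j hij => ?_⟩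
  have hne : some i ≠ some j := by simp only [ne_eq, Option.some.injEq]; omega
  by_cases hs : (i : ℕ) < 3 ↔ (j : ℕ) < 3
  · have hm : (i : ℕ) + 1 < n := by omega
    refine .of_two_edges (v := some ⟨i + 1, hm⟩) ((fan_adj_some_some _ _).2 (by simp))
      ((fan_adj_some_some _ _).2 (by simp only; omega)) hne ?_
    have h₁ : min (i : ℕ) (i + 1) = i := by omega
    have h₂ : min ((i : ℕ) + 1) j = i + 1 := by omega
    simp only [fanColoring_some_some, h₁, h₂]
    split_ifs <;> omega
  · refine .of_two_edges (fan_adj_some_none i) (fan_adj_none_some j) hne ?_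
    simp only [fanColoring_some_none, fanColoring_none_some]
    split_ifs <;> omega

theorem exists_isRainbowColoring_fan_three (n : ℕ) :
    ∃ c : Sym2 (Option (Fin n)) → Fin 3, IsRainbowColoring (fan n) c := by
  refine ⟨fanColoring n (fun i => if i % 2 = 0 then 0 else 1) (fun _ => 2),
    isRainbowColoring_fan fun i j hij => ?_⟩
  have hne : some i ≠ some j := by simp only [ne_eq, Option.some.injEq]; omega
  by_cases hs : (i : ℕ) % 2 = (j : ℕ) % 2
  · have hm : (i : ℕ) + 1 < n := by omega
    refine .of_three_edges (v := some ⟨i + 1, hm⟩) ((fan_adj_some_some _ _).2 (by simp))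
      (fan_adj_some_none _) (fan_adj_none_some j) (by simp) hne
      (by simp only [ne_eq, Option.some.injEq, Fin.ext_iff]; omega) ?_ ?_ ?_ <;>
    simp only [fanColoring_some_some, fanColoring_some_none, fanColoring_none_some] <;>
    split_ifs <;> omega
  · refine .of_two_edges (fan_adj_some_none i) (fan_adj_none_some j) hne ?_
    simp only [fanColoring_some_none, fanColoring_none_some]
    split_ifs <;> omega

theorem rc_eq_of_isLeast {V : Type*} {G : SimpleGraph V} {k : ℕ}
    (hex : ∃ c : Sym2 V → Fin k, IsRainbowColoring G c)
    (hle : ∀ (m : ℕ) (c : Sym2 V → Fin m), IsRainbowColoring G c → k ≤ m) : rc G = k :=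
  IsLeast.csInf_eq ⟨hex, fun m ⟨c, hc⟩ => hle m c hc⟩

/-- With at most two colors, path vertices at distance at least three along the path are rainbow
connected only through the center. -/
theorem IsRainbowColoring.spokes_ne {n m : ℕ} {c : Sym2 (Option (Fin n)) → Fin m}
    (hc : IsRainbowColoring (fan n) c) (hm : m ≤ 2) {i j : Fin n} (hij : (i : ℕ) + 3 ≤ j) :
    c s(some i, none) ≠ c s(some j, none) := by
  obtain ⟨p, -, hp⟩ := hc (some i) (some j)
  have hlen := p.length_le_of_nodup_map_edges hp
  match p, hp, hlen with
  | .nil, _, _ => omega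
  | .cons h .nil, _, _ =>
    rw [fan_adj_some_some] at h
    omega
  | .cons (v := none) h (.cons h' .nil), hp, _ =>
    rw [Sym2.eq_swap (a := some j)]
    simpa using hp
  | .cons (v := some k) h (.cons h' .nil), _, _ =>
    rw [fan_adj_some_some] at h h'
    omega
  | .cons _ (.cons _ (.cons _ _)), _, hlen =>
    simp only [Walk.length_cons] at hlen
    omega

theorem IsRainbowColoring.two_le_of_fan {n m : ℕ} (hn : 3 ≤ n)
    {c : Sym2 (Option (Fin n)) → Fin m} (hc : IsRainbowColoring (fan n) c) : 2 ≤ m := by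
  obtain ⟨p, -, hp⟩ := hc (some ⟨0, by omega⟩) (some ⟨2, by omega⟩)
  have hlen := p.length_le_of_nodup_map_edges hp
  match p, hlen with
  | .cons h .nil, _ =>
    rw [fan_adj_some_some] at h
    simp at h
  | .cons _ (.cons _ _), hlen =>
    simp only [Walk.length_cons] at hlen
    omega

theorem IsRainbowColoring.three_le_of_fan {n m : ℕ} (hn : 7 ≤ n)
    {c : Sym2 (Option (Fin n)) → Fin m} (hc : IsRainbowColoring (fan n) c) : 3 ≤ m := by
  by_contra! hm
  have h (i j : ℕ) (hij : i + 3 ≤ j) (hj : j < n) :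
      c s(some ⟨i, by omega⟩, none) ≠ c s(some ⟨j, hj⟩, none) :=
    hc.spokes_ne (by omega) hij
  have h₀₃ := h 0 3 (by omega) (by omega)
  have h₃₆ := h 3 6 (by omega) (by omega)
  have h₀₆ := h 0 6 (by omega) (by omega)
  omega

/-- The rainbow connection number of the fan graph: `rc(Fan_2) = 1`,
`rc(Fan_n) = 2` for `3 ≤ n ≤ 6`, and `rc(Fan_n) = 3` for `n ≥ 7`. -/
theorem rc_fan (n : ℕ) (hn : 2 ≤ n) :
    (n = 2 → rc (fan n) = 1) ∧
      (3 ≤ n → n ≤ 6 → rc (fan n) = 2) ∧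
      (7 ≤ n → rc (fan n) = 3) := by
  refine ⟨?_, fun h₃ h₆ => ?_, fun h₇ => ?_⟩
  · rintro rfl
    exact rc_eq_of_isLeast ⟨fun _ => 0, isRainbowColoring_fan_two _⟩
      fun m c _ => Nat.succ_le_of_lt (c s(none, none)).pos
  · exact rc_eq_of_isLeast (exists_isRainbowColoring_fan_of_le_six h₆)
      fun _ _ hc => hc.two_le_of_fan h₃
  · exact rc_eq_of_isLeast (exists_isRainbowColoring_fan_three n)
      fun _ _ hc => hc.three_le_of_fan h₇
end

section
/- If G is a finite connected chordal graph, then 2·rad(G) − 2 ≤ diam(G) ≤ 2·rad(G). -/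
open SimpleGraph

/-- A graph is chordal if it contains no induced cycle of length at least 4,
i.e., there is no graph embedding of `C_n` into `G` for any `n ≥ 4`. -/
def IsChordal {V : Type*} (G : SimpleGraph V) : Prop :=
  ∀ n : ℕ, 4 ≤ n → IsEmpty (SimpleGraph.cycleGraph n ↪g G)

namespace SimpleGraph

variable {V : Type*} {G : SimpleGraph V}

/-- The vertices outside `C` with a neighbor in `C`. -/
def outerBoundary (G : SimpleGraph V) (C : Set V) : Set V :=
  {s | s ∉ C ∧ ∃ c ∈ C, G.Adj c s}

/-- Any two vertices of `C` are joined by a walk that stays in `C`. -/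
def WalkConnectedOn (G : SimpleGraph V) (C : Set V) : Prop :=
  ∀ a ∈ C, ∀ b ∈ C, ∃ p : G.Walk a b, ∀ v ∈ p.support, v ∈ C

lemma Walk.dist_getVert_of_length_eq_dist {u v : V} (p : G.Walk u v)
    (hp : p.length = G.dist u v) {i : ℕ} (hi : i ≤ p.length) : G.dist u (p.getVert i) = i := by
  have h₁ : G.dist u (p.getVert i) ≤ i := by
    simpa [Walk.take_length, hi] using dist_le (p.take i)
  have h₂ := dist_le (p.drop i)
  rw [Walk.drop_length] at h₂
  obtain ⟨q, hq⟩ := (p.take i).reachable.exists_walk_length_eq_dist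
  obtain ⟨q', hq'⟩ := (p.drop i).reachable.exists_walk_length_eq_dist
  have h₃ := dist_le (q.append q')
  rw [Walk.length_append] at h₃
  omega

lemma Walk.dist_le_length_of_mem_support {u v w : V} (p : G.Walk u v) (hw : w ∈ p.support) :
    G.dist u w ≤ p.length := by
  classical
  exact (dist_le (p.takeUntil w hw)).trans (p.length_takeUntil_le_length hw)

/-- In a chordal graph, two neighbors of `z` joined by a walk whose inner vertices lie outside
the closed neighborhood of `z` are equal or adjacent. -/
lemma eq_or_adj_of_walk_avoiding_neighbors (hG : IsChordal G) {x y z : V} (hx : G.Adj z x)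
    (hy : G.Adj z y) (p : G.Walk x y)
    (hp : ∀ v ∈ p.support, v = x ∨ v = y ∨ (v ≠ z ∧ ¬ G.Adj z v)) : x = y ∨ G.Adj x y := by
  set W : Set V := {v | v = x ∨ v = y ∨ (v ≠ z ∧ ¬ G.Adj z v)}
  obtain ⟨q, hq⟩ := (p.induce W hp).reachable.exists_walk_length_eq_dist
  set k := q.length with hk
  have hdist : ∀ i ≤ k, (G.induce W).dist _ (q.getVert i) = i := fun i hi =>
    q.dist_getVert_of_length_eq_dist hq hi
  have h0 : (q.getVert 0 : V) = x := by simp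
  have hlast : (q.getVert k : V) = y := by simp [hk]
  have hstep : ∀ i < k, G.Adj (q.getVert i : V) (q.getVert (i + 1)) := fun i hi =>
    q.adj_getVert_succ hi
  rcases Nat.lt_or_ge k 2 with hk2 | hk2
  · interval_cases k
    · exact Or.inl (h0.symm.trans hlast)
    · right
      have := hstep 0 one_pos
      rwa [h0, hlast] at this
  have hinj : ∀ i ≤ k, ∀ j ≤ k, (q.getVert i : V) = q.getVert j → i = j := by
    intro i hi j hj h
    rw [← hdist i hi, ← hdist j hj, Subtype.ext h]
  have hadj : ∀ i ≤ k, ∀ j ≤ k,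
      G.Adj (q.getVert i : V) (q.getVert j) ↔ i + 1 = j ∨ j + 1 = i := by
    intro i hi j hj
    refine ⟨fun h => ?_, ?_⟩
    · have hne : i ≠ j := fun e => h.ne (by rw [e])
      have h' : (G.induce W).Adj (q.getVert i) (q.getVert j) := h
      have key : ∀ a ≤ k, ∀ b ≤ k, (G.induce W).Adj (q.getVert a) (q.getVert b) → b ≤ a + 1 := by
        intro a ha b hb hab
        obtain ⟨w, hw⟩ := (q.take a).reachable.exists_walk_length_eq_dist
        have := dist_le (w.concat hab)
        rwa [Walk.length_concat, hw, hdist a ha, hdist b hb] at this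
      have := key i hi j hj h'
      have := key j hj i hi h'.symm
      omega
    · rintro (rfl | rfl)
      · exact hstep i (by omega)
      · exact (hstep j (by omega)).symm
  have hz : ∀ i ≤ k, G.Adj z (q.getVert i) ↔ i = 0 ∨ i = k := by
    intro i hi
    constructor
    · intro h
      rcases (q.getVert i).2 with e | e | e
      · exact Or.inl (hinj i hi 0 (by omega) (e.trans h0.symm))
      · exact Or.inr (hinj i hi k le_rfl (e.trans hlast.symm))
      · exact (e.2 h).elim
    · rintro (rfl | rfl)
      · rwa [h0]
      · rwa [hlast]
  have hzne : ∀ i ≤ k, (q.getVert i : V) ≠ z := by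
    intro i hi
    rcases (q.getVert i).2 with e | e | e
    · rw [e]; exact hx.ne'
    · rw [e]; exact hy.ne'
    · exact e.1
  let f : Fin (k + 2) → V := fun i => if (i : ℕ) = k + 1 then z else q.getVert i
  have hf : Function.Injective f := by
    intro i j hij
    have hi := i.isLt
    have hj := j.isLt
    ext
    simp only [f] at hij
    split_ifs at hij with h₁ h₂ h₂
    · omega
    · exact (hzne j (by omega) hij.symm).elim
    · exact (hzne i (by omega) hij).elim
    · exact hinj i (by omega) j (by omega) hij
  refine ((hG (k + 2) (by omega)).false ⟨⟨f, hf⟩, ?_⟩).elim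
  intro i j
  have hi := i.isLt
  have hj := j.isLt
  have hcyc : (cycleGraph (k + 2)).Adj i j ↔ ((i : ℕ) + 1 = j ∨ (j : ℕ) + 1 = i) ∨
      ((i : ℕ) = k + 1 ∧ (j : ℕ) = 0) ∨ ((j : ℕ) = k + 1 ∧ (i : ℕ) = 0) := by
    rw [cycleGraph_adj', Fin.val_sub, Fin.val_sub]
    have hmod : ∀ a < k + 2, ∀ b < k + 2,
        (k + 2 - b + a) % (k + 2) = if b ≤ a then a - b else k + 2 - b + a := by
      intro a ha b hb
      split_ifs with h
      · rw [show k + 2 - b + a = a - b + (k + 2) by omega, Nat.add_mod_right,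
          Nat.mod_eq_of_lt (by omega)]
      · exact Nat.mod_eq_of_lt (by omega)
    rw [hmod _ hi _ hj, hmod _ hj _ hi]
    split_ifs <;> omega
  rw [hcyc]
  change G.Adj (f i) (f j) ↔ _
  simp only [f]
  split_ifs with h₁ h₂ h₂
  · simp only [SimpleGraph.irrefl, false_iff]; omega
  · rw [hz j (by omega)]; omega
  · rw [adj_comm, hz i (by omega)]; omega
  · rw [hadj i (by omega) j (by omega)]; omega

lemma Walk.exists_walk_to_first_neighbor {C : Set V} {s a b : V} (p : G.Walk a b)
    (hp : ∀ v ∈ p.support, v ∈ C) (hb : G.Adj s b) :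
    ∃ (b' : V) (q : G.Walk a b'), b' ∈ C ∧ G.Adj s b' ∧
      ∀ v ∈ q.support, v = b' ∨ (v ∈ C ∧ ¬ G.Adj s v) := by
  induction p with
  | nil => exact ⟨_, .nil, hp _ (by simp), hb, by simp⟩
  | @cons u v w h p ih =>
    by_cases hu : G.Adj s u
    · exact ⟨u, .nil, hp _ (by simp), hu, by simp⟩
    · obtain ⟨b', q, hb'C, hb', hq⟩ := ih (fun v hv => hp v (by simp [hv])) hb
      refine ⟨b', .cons h q, hb'C, hb', fun x hx => ?_⟩
      rw [Walk.support_cons, List.mem_cons] at hx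
      rcases hx with rfl | hx
      · exact Or.inr ⟨hp _ (by simp), hu⟩
      · exact hq x hx

/-- In a chordal graph, if a connected set has a clique as its outer boundary, some vertex of the
set is adjacent to the whole boundary. -/
lemma exists_adj_outerBoundary [Finite V] (hG : IsChordal G) {C : Set V} (hne : C.Nonempty)
    (hC : WalkConnectedOn G C) (hS : G.IsClique (outerBoundary G C)) :
    ∃ c ∈ C, ∀ s ∈ outerBoundary G C, G.Adj s c := by
  obtain ⟨c, hcC, hmax⟩ := Set.exists_max_image C
    (fun c => {s ∈ outerBoundary G C | G.Adj s c}.ncard) C.toFinite hne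
  refine ⟨c, hcC, fun s hs => ?_⟩
  by_contra hsc
  obtain ⟨b, hbC, hbs⟩ := hs.2
  obtain ⟨p, hp⟩ := hC c hcC b hbC
  obtain ⟨b', q, hb'C, hb', hq⟩ := p.exists_walk_to_first_neighbor hp hbs.symm
  refine (hmax b' hb'C).not_gt (Set.ncard_lt_ncard ?_ (Set.toFinite _))
  refine (Set.ssubset_iff_of_subset ?_).2 ⟨s, ⟨hs, hb'⟩, fun h => hsc h.2⟩
  rintro t ⟨ht, htc⟩
  refine ⟨ht, ?_⟩
  have hst : G.Adj s t := hS hs ht (by rintro rfl; exact hsc htc)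
  refine (eq_or_adj_of_walk_avoiding_neighbors hG hst hb' (.cons htc q) fun v hv => ?_).resolve_left
    (by rintro rfl; exact ht.1 hb'C)
  rw [Walk.support_cons, List.mem_cons] at hv
  rcases hv with rfl | hv
  · exact Or.inl rfl
  · rcases hq v hv with rfl | h
    · exact Or.inr (Or.inl rfl)
    · exact Or.inr (Or.inr ⟨by rintro rfl; exact hs.1 h.1, h.2⟩)

lemma Walk.support_subset_of_disjoint_outerBoundary {C : Set V} {a b : V} (p : G.Walk a b)
    (ha : a ∈ C) (hp : ∀ v ∈ p.support, v ∉ outerBoundary G C) : ∀ v ∈ p.support, v ∈ C := by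
  induction p with
  | nil => simpa using ha
  | @cons u v w h p ih =>
    have hv : v ∈ C := by
      by_contra hv
      exact hp v (by simp) ⟨hv, u, ha, h⟩
    intro x hx
    rw [Walk.support_cons, List.mem_cons] at hx
    rcases hx with rfl | hx
    · exact ha
    · exact ih hv (fun y hy => hp y (by simp [hy])) x hx

/-- In a connected graph, if `u` and `v` are within distance `2 * r + 1` and the closed `r`-ball
around `v` is contained in `C`, the closed `r`-ball around `u` meets `C` or its outer boundary. -/
lemma Connected.exists_dist_le_mem_or_mem_outerBoundary (hG : G.Connected) {C : Set V} {r : ℕ}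
    {u v : V} (huv : G.dist u v ≤ 2 * r + 1) (hv : ∀ x, G.dist v x ≤ r → x ∈ C) :
    ∃ w, G.dist u w ≤ r ∧ (w ∈ C ∨ w ∈ outerBoundary G C) := by
  obtain ⟨p, hp⟩ := hG.exists_walk_length_eq_dist u v
  rcases Nat.lt_or_ge r p.length with hr | hr
  · refine ⟨p.getVert r, (p.dist_getVert_of_length_eq_dist hp hr.le).le, ?_⟩
    have h : p.getVert (r + 1) ∈ C := by
      apply hv
      rw [dist_comm]
      refine (dist_le (p.drop (r + 1))).trans ?_
      rw [Walk.drop_length]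
      omega
    by_cases hw : p.getVert r ∈ C
    · exact Or.inl hw
    · exact Or.inr ⟨hw, _, h, (p.adj_getVert_succ hr).symm⟩
  · exact ⟨v, by omega, Or.inl (hv v (by simp))⟩

lemma exists_forall_dist_le_of_ball_subset [Finite V] (hG : G.Connected) (hchordal : IsChordal G)
    {r : ℕ} (hr : ∀ u v, G.dist u v ≤ 2 * r + 1) (C : Set V) (hC : WalkConnectedOn G C)
    (hS : G.IsClique (outerBoundary G C)) {v : V} (hv : ∀ x, G.dist v x ≤ r → x ∈ C) :
    ∃ c, ∀ u, G.dist c u ≤ r + 1 := by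
  induction hn : C.ncard using Nat.strong_induction_on generalizing C v with
  | _ n ih =>
  obtain ⟨c, hcC, hc⟩ := exists_adj_outerBoundary hchordal ⟨v, hv v (by simp)⟩ hC hS
  by_cases hall : ∀ u, ∃ w, (w ∈ outerBoundary G C ∨ w = c) ∧ G.dist u w ≤ r
  · refine ⟨c, fun u => ?_⟩
    obtain ⟨w, hw, huw⟩ := hall u
    have hcw : G.dist c w ≤ 1 := by
      rcases hw with hw | rfl
      · exact (dist_eq_one_iff_adj.2 (hc w hw).symm).le
      · simp
    have := hG.dist_triangle (u := c) (v := w) (w := u)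
    rw [dist_comm (u := w)] at this
    omega
  push Not at hall
  obtain ⟨u, hu⟩ := hall
  have huS : ∀ x, G.dist u x ≤ r → x ∉ outerBoundary G C := fun x hx h =>
    (hu x (Or.inl h)).not_ge hx
  obtain ⟨w, huw, hw⟩ := hG.exists_dist_le_mem_or_mem_outerBoundary (hr u v) hv
  have hwC : w ∈ C := hw.resolve_right (huS w huw)
  let C' : Set V := {x | ∃ p : G.Walk w x, ∀ y ∈ p.support, y ∈ C ∧ y ≠ c}
  have hsub : ∀ x ∈ C', x ∈ C ∧ x ≠ c := fun x ⟨p, hp⟩ => hp x p.end_mem_support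
  have hsupp : ∀ {x} (p : G.Walk w x), (∀ y ∈ p.support, y ∈ C ∧ y ≠ c) →
      ∀ y ∈ p.support, y ∈ C' := by
    classical
    exact fun p hp y hy => ⟨p.takeUntil y hy, fun z hz =>
      hp z (p.support_takeUntil_subset_support hy hz)⟩
  refine ih C'.ncard (hn ▸ Set.ncard_lt_ncard ?_ C.toFinite) C' ?_ ?_ (v := u) ?_ rfl
  · exact (Set.ssubset_iff_of_subset fun x hx => (hsub x hx).1).2
      ⟨c, hcC, fun h => (hsub c h).2 rfl⟩
  · rintro a ⟨p, hp⟩ b ⟨q, hq⟩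
    refine ⟨p.reverse.append q, fun y hy => ?_⟩
    rw [Walk.mem_support_append_iff, Walk.support_reverse, List.mem_reverse] at hy
    exact hy.elim (hsupp p hp y) (hsupp q hq y)
  · have hbd : ∀ x ∈ outerBoundary G C', x ∈ outerBoundary G C ∨ x = c := by
      rintro x ⟨hx, a, ⟨p, hp⟩, hax⟩
      by_contra! h
      have hxC : x ∈ C := by
        by_contra hxC
        exact h.1 ⟨hxC, a, (hp a p.end_mem_support).1, hax⟩
      refine hx ⟨p.concat hax, fun y hy => ?_⟩
      rw [Walk.support_concat, List.mem_append, List.mem_singleton] at hy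
      rcases hy with hy | rfl
      · exact hp y hy
      · exact ⟨hxC, h.2⟩
    intro a ha b hb hab
    rcases hbd a ha with haS | rfl <;> rcases hbd b hb with hbS | rfl
    · exact hS haS hbS hab
    · exact hc a haS
    · exact (hc b hbS).symm
    · exact (hab rfl).elim
  · intro x hx
    obtain ⟨p, hp⟩ := hG.exists_walk_length_eq_dist u w
    obtain ⟨q, hq⟩ := hG.exists_walk_length_eq_dist u x
    have hball : ∀ y ∈ (p.reverse.append q).support, G.dist u y ≤ r := by
      intro y hy
      rw [Walk.mem_support_append_iff, Walk.support_reverse, List.mem_reverse] at hy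
      rcases hy with hy | hy
      · exact (p.dist_le_length_of_mem_support hy).trans (hp.trans_le huw)
      · exact (q.dist_le_length_of_mem_support hy).trans (hq.trans_le hx)
    refine ⟨p.reverse.append q, fun y hy => ⟨?_, ?_⟩⟩
    · exact Walk.support_subset_of_disjoint_outerBoundary _ hwC
        (fun y hy => huS y (hball y hy)) y hy
    · rintro rfl
      exact (hu y (Or.inr rfl)).not_ge (hball y hy)

/-- A finite connected chordal graph in which any two vertices are within distance `2 * r + 1`
has a vertex within distance `r + 1` of every vertex. -/
theorem exists_forall_dist_le_of_isChordal [Finite V] (hG : G.Connected) (hchordal : IsChordal G)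
    {r : ℕ} (hr : ∀ u v, G.dist u v ≤ 2 * r + 1) : ∃ c, ∀ u, G.dist c u ≤ r + 1 := by
  obtain ⟨v⟩ := hG.nonempty
  refine exists_forall_dist_le_of_ball_subset hG hchordal hr Set.univ (v := v) ?_ ?_ (by simp)
  · exact fun a _ b _ => ⟨(hG.preconnected a b).some, by simp⟩
  · exact fun a ha => (ha.1 trivial).elim

end SimpleGraph

/-- For every finite connected chordal graph `G`,
`2·rad(G) − 2 ≤ diam(G) ≤ 2·rad(G)`. -/
theorem chordal_diam_bounds {V : Type*} [Fintype V] (G : SimpleGraph V)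
    (hG : G.Connected) (hchordal : IsChordal G) :
    2 * graphRadius G - 2 ≤ graphDiam G ∧ graphDiam G ≤ 2 * graphRadius G := by
  have hrad_le : ∀ v, graphRadius G ≤ eccentricity G v := fun v => Nat.sInf_le ⟨v, rfl⟩
  have hdist_ecc : ∀ u v, G.dist u v ≤ eccentricity G u := fun u v =>
    Finset.le_sup (f := fun w => G.dist u w) (Finset.mem_univ v)
  have hdist_diam : ∀ u v, G.dist u v ≤ graphDiam G := fun u v =>
    Finset.le_sup (f := fun p : V × V => G.dist p.1 p.2) (Finset.mem_univ (u, v))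
  constructor
  · obtain ⟨c, hc⟩ := exists_forall_dist_le_of_isChordal hG hchordal (r := graphDiam G / 2)
      fun u v => (hdist_diam u v).trans (by omega)
    have : eccentricity G c ≤ graphDiam G / 2 + 1 := Finset.sup_le fun u _ => hc u
    have := hrad_le c
    omega
  · have := hG.nonempty
    obtain ⟨c, hc⟩ : graphRadius G ∈ Set.range (eccentricity G) :=
      Nat.sInf_mem (Set.range_nonempty _)
    refine Finset.sup_le fun p _ => ?_
    have h := hG.dist_triangle (u := p.1) (v := c) (w := p.2)
    rw [dist_comm (u := p.1) (v := c)] at h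
    have h₁ := hdist_ecc c p.1
    have h₂ := hdist_ecc c p.2
    omega
end

section
/- If D is a connected two-way dominating set in a finite connected graph G, then rc(G) ≤ rc(G[D]) + 3, where G[D] is the subgraph of G induced by D. -/
open SimpleGraph

/-- Every graph has a bipartition of its vertices in which each non-isolated vertex has a neighbor
on the other side. -/
theorem SimpleGraph.exists_bool_forall_adj_exists_adj_ne {V : Type*} (H : SimpleGraph V) :
    ∃ f : V → Bool, ∀ v w, H.Adj v w → ∃ x, H.Adj v x ∧ f x = !f v := by
  have key (C : H.ConnectedComponent) : ∃ r, H.connectedComponentMk r = C := C.exists_rep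
  choose root hroot using key
  let r (v : V) : V := root (H.connectedComponentMk v)
  have hr (v : V) : H.Reachable v (r v) :=
    SimpleGraph.ConnectedComponent.exact (hroot (H.connectedComponentMk v)).symm
  have hr_adj {v w : V} (h : H.Adj v w) : r w = r v :=
    congrArg root (SimpleGraph.ConnectedComponent.sound h.reachable).symm
  refine ⟨fun v => decide (H.dist v (r v) % 2 = 0), fun v w hvw => ?_⟩
  suffices ∃ x, H.Adj v x ∧
      (H.dist x (r v) = H.dist v (r v) + 1 ∨ H.dist v (r v) = H.dist x (r v) + 1) by
    obtain ⟨x, hx, hd⟩ := this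
    refine ⟨x, hx, ?_⟩
    simp only [Bool.eq_not, hr_adj hx, ne_eq, decide_eq_decide]
    omega
  obtain ⟨p, hp⟩ := (hr v).exists_walk_length_eq_dist
  generalize r v = z at p hp
  cases p with
  | nil =>
    refine ⟨w, hvw, Or.inl ?_⟩
    rw [SimpleGraph.dist_self, SimpleGraph.dist_eq_one_iff_adj.mpr hvw.symm]
  | @cons _ x _ h p =>
    refine ⟨x, h, Or.inr ?_⟩
    have h₁ := SimpleGraph.dist_le p
    obtain ⟨q, hq⟩ := p.reachable.exists_walk_length_eq_dist
    have h₂ := SimpleGraph.dist_le (SimpleGraph.Walk.cons h q)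
    simp only [SimpleGraph.Walk.length_cons] at hp h₂
    omega

/-- To check that a coloring is a rainbow coloring, it suffices to find rainbow walks. -/
theorem isRainbowColoring_of_walk {V α : Type*} {G : SimpleGraph V} {c : Sym2 V → α}
    (h : ∀ u v : V, ∃ p : G.Walk u v, (p.edges.map c).Nodup) : IsRainbowColoring G c := by
  classical
  intro u v
  obtain ⟨p, hp⟩ := h u v
  have hpath := p.bypass_isPath
  refine ⟨p.bypass, hpath, List.Nodup.map_on ?_ hpath.isTrail.edges_nodup⟩
  intro x hx y hy
  exact List.inj_on_of_nodup_map hp (p.edges_bypass_subset_edges hx) (p.edges_bypass_subset_edges hy)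

theorem IsRainbowColoring.comp_injective {V α β : Type*} {G : SimpleGraph V} {c : Sym2 V → α}
    (h : IsRainbowColoring G c) {e : α → β} (he : Function.Injective e) :
    IsRainbowColoring G (e ∘ c) := by
  intro u v
  obtain ⟨p, hp, hc⟩ := h u v
  refine ⟨p, hp, ?_⟩
  rw [← List.map_map]
  exact hc.map he

/-- A connected finite graph has a rainbow coloring with `rc G` colors. -/
theorem SimpleGraph.Connected.exists_isRainbowColoring_rc {V : Type*} [Finite V]
    {G : SimpleGraph V} (hG : G.Connected) : ∃ c : Sym2 V → Fin (rc G), IsRainbowColoring G c := by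
  refine Nat.sInf_mem (s := {n : ℕ | ∃ c : Sym2 V → Fin n, IsRainbowColoring G c}) ?_
  refine ⟨Nat.card (Sym2 V), Finite.equivFin (Sym2 V), fun u v => ?_⟩
  obtain ⟨p, hp⟩ := hG.exists_isPath u v
  exact ⟨p, hp, hp.isTrail.edges_nodup.map (Equiv.injective _)⟩

section Extension

open Classical in
/-- Extend an edge-coloring `c` of the subgraph induced by `D` by three new colors: an edge joining
`v ∉ D` to `d ∈ D` gets color `0` or `1` according to `A v d`, all other edges get color `2`. -/
noncomputable def extendColoring {V α : Type*} (D : Set V) (c : Sym2 D → α) (A : V → V → Prop) :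
    Sym2 V → α ⊕ Fin 3 :=
  Function.extend (Sym2.map Subtype.val) (Sum.inl ∘ c) fun e =>
    if ∃ v d, e = s(v, d) ∧ v ∉ D ∧ d ∈ D ∧ A v d then Sum.inr 0
    else if ∃ v d, e = s(v, d) ∧ v ∉ D ∧ d ∈ D then Sum.inr 1
    else Sum.inr 2

variable {V α : Type*} {D : Set V} {c : Sym2 D → α} {A : V → V → Prop}

theorem extendColoring_map (e : Sym2 D) :
    extendColoring D c A (e.map Subtype.val) = Sum.inl (c e) :=
  (Sym2.map.injective Subtype.val_injective).extend_apply _ _ e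

theorem not_exists_map_val_eq {v w : V} (hv : v ∉ D) :
    ¬ ∃ e : Sym2 D, e.map Subtype.val = s(v, w) := by
  rintro ⟨e, he⟩
  have hmem : v ∈ e.map Subtype.val := he ▸ Sym2.mem_mk_left v w
  obtain ⟨x, -, rfl⟩ := Sym2.mem_map.mp hmem
  exact hv x.2

theorem extendColoring_zero {v d : V} (hv : v ∉ D) (hd : d ∈ D) (hA : A v d) :
    extendColoring D c A s(v, d) = Sum.inr 0 := by
  rw [extendColoring, Function.extend_apply' _ _ _ (not_exists_map_val_eq hv), if_pos]
  exact ⟨v, d, rfl, hv, hd, hA⟩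

theorem extendColoring_one {v d : V} (hv : v ∉ D) (hd : d ∈ D) (hA : ¬ A v d) :
    extendColoring D c A s(v, d) = Sum.inr 1 := by
  rw [extendColoring, Function.extend_apply' _ _ _ (not_exists_map_val_eq hv), if_neg, if_pos]
  · exact ⟨v, d, rfl, hv, hd⟩
  · rintro ⟨v', d', he, hv', hd', hA'⟩
    rcases Sym2.eq_iff.mp he with ⟨rfl, rfl⟩ | ⟨rfl, rfl⟩
    · exact hA hA'
    · exact hv hd'

theorem extendColoring_two {v w : V} (hv : v ∉ D) (hw : w ∉ D) :
    extendColoring D c A s(v, w) = Sum.inr 2 := by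
  have hne : ¬ ∃ v' d', s(v, w) = s(v', d') ∧ v' ∉ D ∧ d' ∈ D := by
    rintro ⟨v', d', he, -, hd'⟩
    rcases Sym2.eq_iff.mp he with ⟨rfl, rfl⟩ | ⟨rfl, rfl⟩
    · exact hw hd'
    · exact hv hd'
  rw [extendColoring, Function.extend_apply' _ _ _ (not_exists_map_val_eq hv), if_neg, if_neg hne]
  rintro ⟨v', d', he, hv', hd', -⟩
  exact hne ⟨v', d', he, hv', hd'⟩

/-- There is a walk from `v` to a vertex of `D` whose edges carry the new colors listed in `L`. -/
def HasExit {V α : Type*} (G : SimpleGraph V) (D : Set V) (c : Sym2 V → α ⊕ Fin 3) (v : V)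
    (L : List (Fin 3)) : Prop :=
  ∃ d ∈ D, ∃ p : G.Walk v d, p.edges.map c = L.map Sum.inr

variable {G : SimpleGraph V}

theorem hasExit_nil {v : V} (c : Sym2 V → α ⊕ Fin 3) (hv : v ∈ D) : HasExit G D c v [] :=
  ⟨v, hv, SimpleGraph.Walk.nil, rfl⟩

theorem HasExit.cons {v w : V} {c : Sym2 V → α ⊕ Fin 3} {L : List (Fin 3)} {i : Fin 3}
    (h : HasExit G D c w L) (hvw : G.Adj v w) (hc : c s(v, w) = Sum.inr i) :
    HasExit G D c v (i :: L) := by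
  obtain ⟨d, hd, p, hp⟩ := h
  exact ⟨d, hd, SimpleGraph.Walk.cons hvw p, by simp [hp, hc]⟩

/-- Two exits with disjoint colors can be joined through `D` to a rainbow walk. -/
theorem IsRainbowColoring.exists_walk_of_hasExit (hc : IsRainbowColoring (G.induce D) c)
    {u v : V} {L M : List (Fin 3)} (hu : HasExit G D (extendColoring D c A) u L)
    (hv : HasExit G D (extendColoring D c A) v M) (hLM : (L ++ M).Nodup) :
    ∃ p : G.Walk u v, (p.edges.map (extendColoring D c A)).Nodup := by
  obtain ⟨x, hx, p, hp⟩ := hu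
  obtain ⟨y, hy, q, hq⟩ := hv
  obtain ⟨r, -, hr⟩ := hc ⟨x, hx⟩ ⟨y, hy⟩
  let r' : G.Walk x y := r.map (SimpleGraph.Embedding.induce D).toHom
  have hr' : r'.edges.map (extendColoring D c A) = (r.edges.map c).map Sum.inl := by
    change (r.map (SimpleGraph.Embedding.induce D).toHom).edges.map _ = _
    rw [SimpleGraph.Walk.edges_map, List.map_map, List.map_map]
    exact List.map_congr_left fun e _ => extendColoring_map e
  refine ⟨p.append (r'.append q.reverse), ?_⟩
  rw [SimpleGraph.Walk.edges_append, SimpleGraph.Walk.edges_append,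
    SimpleGraph.Walk.edges_reverse, List.map_append, List.map_append, List.map_reverse, hp, hq, hr']
  rw [List.nodup_append] at hLM
  obtain ⟨hL, hM, hd⟩ := hLM
  have hL' := hL.map (Sum.inr_injective (α := α))
  have hM' := hM.map (Sum.inr_injective (α := α))
  have hr'' := hr.map (Sum.inl_injective (β := Fin 3))
  rw [List.nodup_append, List.nodup_append]
  refine ⟨hL', ⟨hr'', List.nodup_reverse.mpr hM', ?_⟩, ?_⟩
  · simp
  · rintro a ha b hb rfl
    obtain ⟨i, hi, rfl⟩ := List.mem_map.mp ha
    rcases List.mem_append.mp hb with hb | hb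
    · simp at hb
    · rw [List.mem_reverse, List.mem_map] at hb
      obtain ⟨j, hj, hij⟩ := hb
      exact hd i hi j hj (Sum.inr_injective hij).symm

/-- If every vertex outside `D` has an exit in one of the colors `0`, `1` and a second exit avoiding
that color, then the extended coloring is a rainbow coloring. -/
theorem IsRainbowColoring.extendColoring (hc : IsRainbowColoring (G.induce D) c)
    (hexit : ∀ v ∉ D,
      (HasExit G D (extendColoring D c A) v [0] ∧ (HasExit G D (extendColoring D c A) v [1] ∨
        HasExit G D (extendColoring D c A) v [2, 1])) ∨
      (HasExit G D (extendColoring D c A) v [1] ∧ (HasExit G D (extendColoring D c A) v [0] ∨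
        HasExit G D (extendColoring D c A) v [2, 0]))) :
    IsRainbowColoring G (extendColoring D c A) := by
  refine isRainbowColoring_of_walk fun u v => ?_
  by_cases hu : u ∈ D <;> by_cases hv : v ∈ D
  · exact hc.exists_walk_of_hasExit (hasExit_nil _ hu) (hasExit_nil _ hv) (by decide)
  · rcases hexit v hv with ⟨h, -⟩ | ⟨h, -⟩ <;>
      exact hc.exists_walk_of_hasExit (hasExit_nil _ hu) h (by decide)
  · rcases hexit u hu with ⟨h, -⟩ | ⟨h, -⟩ <;>
      exact hc.exists_walk_of_hasExit h (hasExit_nil _ hv) (by decide)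
  · rcases hexit u hu with ⟨h, h' | h'⟩ | ⟨h, h' | h'⟩ <;>
      rcases hexit v hv with ⟨k, -⟩ | ⟨k, -⟩ <;>
      first
      | exact hc.exists_walk_of_hasExit h k (by decide)
      | exact hc.exists_walk_of_hasExit h' k (by decide)

end Extension

/-- A rainbow coloring of the subgraph induced by a two-way dominating set extends to the whole
graph with three new colors. -/
theorem IsRainbowColoring.exists_extension {V α : Type*} {G : SimpleGraph V} {D : Set V}
    {c : Sym2 D → α} (hc : IsRainbowColoring (G.induce D) c)
    (hdom : ∀ v : V, v ∉ D → ∃ u ∈ D, G.Adj u v)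
    (hpendant : ∀ v : V, (G.neighborSet v).ncard = 1 → v ∈ D) :
    ∃ c' : Sym2 V → α ⊕ Fin 3, IsRainbowColoring G c' := by
  obtain ⟨f, hf⟩ := (G.induce Dᶜ).spanningCoe.exists_bool_forall_adj_exists_adj_ne
  have hadj (v w : V) : (G.induce Dᶜ).spanningCoe.Adj v w ↔ G.Adj v w ∧ v ∉ D ∧ w ∉ D := by
    simp
  simp only [hadj] at hf
  have hdom' (v : V) : ∃ u, v ∉ D → u ∈ D ∧ G.Adj v u := by
    by_cases hv : v ∈ D
    · exact ⟨v, fun h => absurd hv h⟩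
    · obtain ⟨u, hu, huv⟩ := hdom v hv
      exact ⟨u, fun _ => ⟨hu, huv.symm⟩⟩
  choose g hg using hdom'
  let N (v : V) : Prop := ∃ w ∉ D, G.Adj v w
  let A (v d : V) : Prop := (N v ∧ f v = true) ∨ (¬ N v ∧ d = g v)
  have exit_zero {v d : V} (hv : v ∉ D) (hd : d ∈ D) (h : G.Adj v d) (hA : A v d) :
      HasExit G D (_root_.extendColoring D c A) v [0] :=
    (hasExit_nil _ hd).cons h (extendColoring_zero hv hd hA)
  have exit_one {v d : V} (hv : v ∉ D) (hd : d ∈ D) (h : G.Adj v d) (hA : ¬ A v d) :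
      HasExit G D (_root_.extendColoring D c A) v [1] :=
    (hasExit_nil _ hd).cons h (extendColoring_one hv hd hA)
  refine ⟨_root_.extendColoring D c A, hc.extendColoring fun v hv => ?_⟩
  obtain ⟨hgD, hgv⟩ := hg v hv
  by_cases hN : N v
  · obtain ⟨w, hw, hvw⟩ := hN
    obtain ⟨x, ⟨hvx, -, hx⟩, hfx⟩ := hf v w ⟨hvw, hv, hw⟩
    obtain ⟨hxD, hgx⟩ := hg x hx
    have hNv : N v := ⟨w, hw, hvw⟩
    have hNx : N x := ⟨v, hv, hvx.symm⟩
    have hcol := extendColoring_two (c := c) (A := A) hv hx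
    cases hfv : f v with
    | true =>
      refine Or.inl ⟨exit_zero hv hgD hgv (by simp [A, hNv, hfv]), Or.inr ?_⟩
      exact (exit_one hx hxD hgx (by simp [A, hNx, hfx, hfv])).cons hvx hcol
    | false =>
      refine Or.inr ⟨exit_one hv hgD hgv (by simp [A, hNv, hfv]), Or.inr ?_⟩
      exact (exit_zero hx hxD hgx (by simp [A, hNx, hfx, hfv])).cons hvx hcol
  · have hex : ∃ d, G.Adj v d ∧ d ≠ g v := by
      by_contra! h
      refine hv (hpendant v (Set.ncard_eq_one.mpr ⟨g v, ?_⟩))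
      ext d
      exact ⟨fun hd => h d hd, fun hd => by rw [Set.mem_singleton_iff.mp hd]; exact hgv⟩
    obtain ⟨d, hvd, hne⟩ := hex
    have hd : d ∈ D := by
      by_contra hd
      exact hN ⟨d, hd, hvd⟩
    exact Or.inl ⟨exit_zero hv hgD hgv (by simp [A, hN]),
      Or.inl (exit_one hv hd hvd (by simp [A, hN, hne]))⟩

/-- If `D` is a connected two-way dominating set of a finite connected graph `G`
(a dominating set containing every pendant vertex whose induced subgraph is
connected), then `rc(G) ≤ rc(G[D]) + 3`. -/
theorem rc_le_rc_induced_dominating_add_three {V : Type*} [Fintype V]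
    (G : SimpleGraph V) (hG : G.Connected) (D : Set V)
    (hdom : ∀ v : V, v ∉ D → ∃ u ∈ D, G.Adj u v)
    (hpendant : ∀ v : V, (G.neighborSet v).ncard = 1 → v ∈ D)
    (hconn : (G.induce D).Connected) :
    rc G ≤ rc (G.induce D) + 3 := by
  obtain ⟨c, hc⟩ := hconn.exists_isRainbowColoring_rc
  obtain ⟨c', hc'⟩ := hc.exists_extension hdom hpendant
  exact Nat.sInf_le ⟨_, hc'.comp_injective finSumFinEquiv.injective⟩
end
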